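/- Suppose that q(u) → +∞ as u → −∞ and as u → +∞ (i.e. ω₋ = ω₊ = +∞). Then there exists s₀ ∈ ℝ such that: for s < s₀ the equation (WE_s) has no T-periodic solutions; for s = s₀ it has at least one T-periodic solution; and for s > s₀ it has at least two T-periodic solutions. -/

import Mathlib

open MeasureTheory Set Filter

noncomputable section

/-- The Lebesgue measure restricted to the interval `[0,T]`. -/
def muT (T : ℝ) : Measure ℝ := volume.restrict (Icc 0 T)

/-- `u` is a `C¹` function on `[0,T]` with derivative `u'` there, satisfying the
`T`-periodic boundary conditions `u 0 = u T` and `u' 0 = u' T`. -/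
def IsC1Periodic (T : ℝ) (u u' : ℝ → ℝ) : Prop :=
  (∀ t ∈ Icc (0:ℝ) T, HasDerivWithinAt u (u' t) (Icc (0:ℝ) T) t) ∧
    ContinuousOn u' (Icc (0:ℝ) T) ∧ u 0 = u T ∧ u' 0 = u' T

/-- `φ ∘ u'` is absolutely continuous on `[0,T]`, being the indefinite integral of the
integrable function `w` (which is then its a.e. derivative). -/
def IsACPhiDeriv (T : ℝ) (φ : ℝ → ℝ) (u' w : ℝ → ℝ) : Prop :=
  IntegrableOn w (Icc (0:ℝ) T) ∧
    ∀ t ∈ Icc (0:ℝ) T, φ (u' t) = φ (u' 0) + ∫ τ in (0:ℝ)..t, w τ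

/-- `u` is a `T`-periodic solution of `(φ(u'))' + f(u)u' + a(t) q(u) = s + e(t)`. -/
def IsSolWE (T : ℝ) (φ f q a e : ℝ → ℝ) (s : ℝ) (u : ℝ → ℝ) : Prop :=
  ∃ u' w : ℝ → ℝ, IsC1Periodic T u u' ∧ IsACPhiDeriv T φ u' w ∧
    ∀ᵐ t ∂(muT T), w t + f (u t) * u' t + a t * q (u t) = s + e t

theorem exists_continuous_log {h : ℝ × ℝ → ℂ} (hc : Continuous h) (h0 : ∀ x, h x ≠ 0) :
    ∃ L : ℝ × ℝ → ℂ, Continuous L ∧ ∀ x, Complex.exp (L x) = h x := by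
  obtain ⟨F, ⟨-, hF⟩, -⟩ := Complex.isCoveringMap_exp.existsUnique_continuousMap_lifts
    (A := ℝ × ℝ) ⟨fun x ↦ (⟨h x, h0 x⟩ : {z : ℂ // z ≠ 0}), by fun_prop⟩ 0
    (Complex.log (h 0)) (Subtype.ext (Complex.exp_log (h0 0)))
  exact ⟨F, F.continuous, fun x ↦ congrArg Subtype.val (congrFun hF x)⟩

/-- The identity of the plane has no continuous logarithm along a star-shaped closed curve. -/
theorem no_continuous_log_polar (r : ℝ → ℝ) (hr : Continuous r) (hr0 : ∀ θ, 0 < r θ)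
    (hper : r (2 * Real.pi) = r 0) (L : ℝ → ℂ) (hL : Continuous L)
    (hLper : L (2 * Real.pi) = L 0)
    (hexp : ∀ θ : ℝ, Complex.exp (L θ) = r θ * Complex.exp (θ * Complex.I)) : False := by
  have hlog : Continuous fun θ ↦ Real.log (r θ) := hr.log fun θ ↦ (hr0 θ).ne'
  obtain ⟨c, hc⟩ : ∃ c : ℂ, ∀ θ, L θ - Real.log (r θ) - θ * Complex.I = c := by
    have hone : ∀ θ, Complex.exp (L θ - Real.log (r θ) - θ * Complex.I) = 1 := by
      intro θ
      rw [Complex.exp_sub, Complex.exp_sub, hexp, ← Complex.ofReal_exp, Real.exp_log (hr0 θ)]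
      have : (r θ : ℂ) ≠ 0 := by exact_mod_cast (hr0 θ).ne'
      field_simp [Complex.exp_ne_zero]
    have hcov := Complex.isCoveringMap_exp
    refine ⟨_, fun θ ↦ congrFun (hcov.eq_of_comp_eq (A := ℝ)
      (g₁ := fun θ ↦ L θ - Real.log (r θ) - θ * Complex.I)
      (g₂ := fun _ ↦ L 0 - Real.log (r 0) - (0 : ℝ) * Complex.I)
      (by fun_prop) (by fun_prop) ?_ 0 rfl) θ⟩
    funext θ
    simp only [Function.comp]
    exact Subtype.ext ((hone θ).trans (hone 0).symm)
  have h1 := (hc (2 * Real.pi)).trans (hc 0).symm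
  rw [hLper, hper] at h1
  have h2 := congrArg Complex.im h1
  simp at h2

/-- Two planar maps that agree on a closed set `K₁` and have no zeros in the rest of a box cannot
have different indices on the boundary of the box. -/
theorem false_of_boundary_signs {R S : ℝ} (hR : 0 < R) (hS : 0 < S)
    (X Y X' Y' : ℝ × ℝ → ℝ)
    (hX : Continuous X) (hY : Continuous Y) (hX' : Continuous X') (hY' : Continuous Y')
    (K₁ K₂ : Set (ℝ × ℝ)) (hK₁ : IsClosed K₁) (hK₂ : IsClosed K₂) (hK : ∀ x, x ∈ K₁ ∨ x ∈ K₂)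
    (heq : ∀ x ∈ K₁, X x = X' x ∧ Y x = Y' x)
    (hne : ∀ x ∈ K₂, |x.1| ≤ R → |x.2| ≤ S → ¬ (X x = 0 ∧ Y x = 0))
    (hne' : ∀ x ∈ K₂, |x.1| ≤ R → |x.2| ≤ S → ¬ (X' x = 0 ∧ Y' x = 0))
    (hYb : ∀ c p, |c| = R → |p| ≤ S → Y (c, p) < 0)
    (hXb : ∀ c p, |c| ≤ R → |p| = S → 0 < p * X (c, p))
    (hYb' : ∀ c p, |c| = R → |p| ≤ S → 0 < c * Y' (c, p))
    (hXb' : ∀ c p, |c| ≤ R → |p| = S → 0 < p * X' (c, p)) : False := by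
  classical
  set κ : ℝ × ℝ → ℝ × ℝ := fun x ↦ (max (-R) (min x.1 R), max (-S) (min x.2 S)) with hκ
  have hκc : Continuous κ := by fun_prop
  have hκ1 : ∀ x, |(κ x).1| ≤ R := fun x ↦ abs_le.2
    ⟨le_max_left _ _, max_le (by linarith) (min_le_right _ _)⟩
  have hκ2 : ∀ x, |(κ x).2| ≤ S := fun x ↦ abs_le.2
    ⟨le_max_left _ _, max_le (by linarith) (min_le_right _ _)⟩
  have hκid : ∀ x : ℝ × ℝ, |x.1| ≤ R → |x.2| ≤ S → κ x = x := by
    intro x h1 h2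
    rw [abs_le] at h1 h2
    simp [hκ, h1.1, h1.2, h2.1, h2.2]
  set G : ℝ × ℝ → ℂ := fun x ↦ ⟨X x, Y x⟩ with hG
  set G' : ℝ × ℝ → ℂ := fun x ↦ ⟨X' x, Y' x⟩ with hG'
  have mkc : ∀ {α β : ℝ × ℝ → ℝ}, Continuous α → Continuous β →
      Continuous (fun x ↦ (⟨α x, β x⟩ : ℂ)) := fun ha hb ↦
    Complex.equivRealProdCLM.symm.continuous.comp (ha.prodMk hb)
  have hGc : Continuous G := mkc hX hY
  have hGc' : Continuous G' := mkc hX' hY'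
  have hGne : ∀ x ∈ K₂, |x.1| ≤ R → |x.2| ≤ S → G x ≠ 0 := by
    intro x hx h1 h2 h
    exact hne x hx h1 h2 ⟨congrArg Complex.re h, congrArg Complex.im h⟩
  have hGne' : ∀ x ∈ K₂, |x.1| ≤ R → |x.2| ≤ S → G' x ≠ 0 := by
    intro x hx h1 h2 h
    exact hne' x hx h1 h2 ⟨congrArg Complex.re h, congrArg Complex.im h⟩
  have hGeq : ∀ x ∈ K₁, G x = G' x := fun x hx ↦ Complex.ext (heq x hx).1 (heq x hx).2
  set h : ℝ × ℝ → ℂ := fun x ↦ if κ x ∈ K₁ then 1 else G' (κ x) / G (κ x) with hh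
  have hh2 : ∀ x, κ x ∈ K₂ → h x = G' (κ x) / G (κ x) := by
    intro x hx
    by_cases h1 : κ x ∈ K₁
    · simp only [hh, h1, if_true]
      rw [← hGeq _ h1, div_self (hGne _ hx (hκ1 x) (hκ2 x))]
    · simp only [hh, h1, if_false]
  have hhc : Continuous h := by
    rw [← continuousOn_univ,
      show (univ : Set (ℝ × ℝ)) = κ ⁻¹' K₁ ∪ κ ⁻¹' K₂ from
        (eq_univ_of_forall fun x ↦ hK (κ x)).symm]
    refine ContinuousOn.union_of_isClosed ?_ ?_ (hK₁.preimage hκc) (hK₂.preimage hκc)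
    · exact continuousOn_const.congr fun x hx ↦ if_pos hx
    · refine ContinuousOn.congr ?_ fun x hx ↦ hh2 x hx
      exact (hGc'.comp hκc).continuousOn.div (hGc.comp hκc).continuousOn
        fun x hx ↦ hGne _ hx (hκ1 x) (hκ2 x)
  have hhne : ∀ x, h x ≠ 0 := by
    intro x
    by_cases h1 : κ x ∈ K₁
    · simp [hh, h1]
    · have h2 := (hK (κ x)).resolve_left h1
      rw [hh2 x h2]
      exact div_ne_zero (hGne' _ h2 (hκ1 x) (hκ2 x)) (hGne _ h2 (hκ1 x) (hκ2 x))
  obtain ⟨L, hLc, hL⟩ := exists_continuous_log hhc hhne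
  set g₁ : ℝ × ℝ → ℂ := fun x ↦ ⟨x.2, -1⟩ with hg₁
  have hg₁c : Continuous g₁ := mkc continuous_snd continuous_const
  have hg₁ne : ∀ x, g₁ x ≠ 0 := fun x hx ↦ by simpa [hg₁] using congrArg Complex.im hx
  obtain ⟨L₁, hL₁c, hL₁⟩ := exists_continuous_log hg₁c hg₁ne
  set g₂ : ℝ × ℝ → ℂ := fun x ↦ ⟨x.2, x.1⟩ with hg₂
  have hg₂c : Continuous g₂ := mkc continuous_snd continuous_fst
  -- the boundary of the box in polar coordinates
  set ρ : ℝ → ℝ := fun θ ↦ (max (|Real.sin θ| / R) (|Real.cos θ| / S))⁻¹ with hρ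
  have hρpos' : ∀ θ, 0 < max (|Real.sin θ| / R) (|Real.cos θ| / S) := by
    intro θ
    by_cases hs : Real.sin θ = 0
    · have : Real.cos θ ≠ 0 := fun hc ↦ by
        have := Real.sin_sq_add_cos_sq θ; rw [hs, hc] at this; norm_num at this
      exact lt_max_of_lt_right (by positivity)
    · exact lt_max_of_lt_left (by positivity)
  have hρpos : ∀ θ, 0 < ρ θ := fun θ ↦ inv_pos.2 (hρpos' θ)
  have hρc : Continuous ρ := by
    refine Continuous.inv₀ (by fun_prop) fun θ ↦ (hρpos' θ).ne'
  set b : ℝ → ℝ × ℝ := fun θ ↦ (ρ θ * Real.sin θ, ρ θ * Real.cos θ) with hb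
  have hbc : Continuous b := by fun_prop
  have hbd : ∀ θ, |(b θ).1| ≤ R ∧ |(b θ).2| ≤ S ∧ (|(b θ).1| = R ∨ |(b θ).2| = S) := by
    intro θ
    have e1 : |(b θ).1| = ρ θ * |Real.sin θ| := by simp [hb, abs_mul, abs_of_pos (hρpos θ)]
    have e2 : |(b θ).2| = ρ θ * |Real.cos θ| := by simp [hb, abs_mul, abs_of_pos (hρpos θ)]
    have hm : ρ θ * max (|Real.sin θ| / R) (|Real.cos θ| / S) = 1 :=
      inv_mul_cancel₀ (hρpos' θ).ne'
    rw [e1, e2]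
    have l1 : |Real.sin θ| = |Real.sin θ| / R * R := by field_simp
    have l2 : |Real.cos θ| = |Real.cos θ| / S * S := by field_simp
    have m1 := mul_le_mul_of_nonneg_left
      (le_max_left (|Real.sin θ| / R) (|Real.cos θ| / S)) (hρpos θ).le
    have m2 := mul_le_mul_of_nonneg_left
      (le_max_right (|Real.sin θ| / R) (|Real.cos θ| / S)) (hρpos θ).le
    rw [hm] at m1 m2
    refine ⟨?_, ?_, ?_⟩
    · rw [l1, ← mul_assoc]; nlinarith
    · rw [l2, ← mul_assoc]; nlinarith
    · rcases max_choice (|Real.sin θ| / R) (|Real.cos θ| / S) with hc | hc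
      · left; rw [hc] at hm; rw [l1, ← mul_assoc, hm, one_mul]
      · right; rw [hc] at hm; rw [l2, ← mul_assoc, hm, one_mul]
  -- no boundary point lies on the segment between opposite directions
  have slit : ∀ z w : ℂ, z ≠ 0 → w ≠ 0 → (∀ k : ℝ, 0 < k → z ≠ -k * w) →
      z / w ∈ Complex.slitPlane := by
    intro z w hz hw hk
    by_contra hcon
    rw [Complex.mem_slitPlane_iff, not_or, not_lt, not_ne_iff] at hcon
    have hzw : z / w = ((z / w).re : ℂ) := Complex.ext rfl (by simpa using hcon.2)
    have hlt : (z / w).re < 0 := by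
      refine lt_of_le_of_ne hcon.1 fun h0 ↦ ?_
      rw [h0] at hzw
      exact div_ne_zero hz hw (by simpa using hzw)
    refine hk (-(z / w).re) (by linarith) ?_
    push_cast
    rw [← hzw]; field_simp
  have hs1 : ∀ θ, G (b θ) / g₁ (b θ) ∈ Complex.slitPlane := by
    intro θ
    obtain ⟨i1, i2, i3⟩ := hbd θ
    rcases i3 with i3 | i3
    · have y := hYb (b θ).1 (b θ).2 i3 i2
      refine slit _ _ (fun hz ↦ y.ne (congrArg Complex.im hz)) (hg₁ne _) fun k hk hz ↦ ?_
      have := congrArg Complex.im hz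
      simp [hG, hg₁] at this
      linarith
    · have x := hXb (b θ).1 (b θ).2 i1 i3
      refine slit _ _ (fun hz ↦ ?_) (hg₁ne _) fun k hk hz ↦ ?_
      · have := congrArg Complex.re hz
        simp [hG] at this
        simp [this] at x
      · have := congrArg Complex.re hz
        simp [hG, hg₁] at this
        simp only [Prod.mk.eta, this] at x
        nlinarith [mul_self_nonneg (b θ).2]
  have hG'b : ∀ θ, G' (b θ) ≠ 0 := by
    intro θ hz
    obtain ⟨i1, i2, i3⟩ := hbd θ
    rcases i3 with i3 | i3
    · have y := hYb' (b θ).1 (b θ).2 i3 i2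
      have := congrArg Complex.im hz
      simp [hG'] at this
      simp [this] at y
    · have y := hXb' (b θ).1 (b θ).2 i1 i3
      have := congrArg Complex.re hz
      simp [hG'] at this
      simp [this] at y
  have hs2 : ∀ θ, g₂ (b θ) / G' (b θ) ∈ Complex.slitPlane := by
    intro θ
    obtain ⟨i1, i2, i3⟩ := hbd θ
    have hg : g₂ (b θ) ≠ 0 := by
      intro hz
      have h1 := congrArg Complex.re hz
      have h2 := congrArg Complex.im hz
      simp only [hg₂, Complex.zero_re, Complex.zero_im] at h1 h2
      rw [h1, h2, abs_zero] at i3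
      rcases i3 with i3 | i3 <;> linarith
    refine slit _ _ hg (hG'b θ) fun k hk hz ↦ ?_
    rcases i3 with i3 | i3
    · have y := hYb' (b θ).1 (b θ).2 i3 i2
      have := congrArg Complex.im hz
      simp [hG', hg₂] at this
      simp only [Prod.mk.eta] at y
      rw [this] at y
      nlinarith [mul_nonneg hk.le (mul_self_nonneg (Y' (b θ)))]
    · have y := hXb' (b θ).1 (b θ).2 i1 i3
      have := congrArg Complex.re hz
      simp [hG', hg₂] at this
      simp only [Prod.mk.eta] at y
      rw [this] at y
      nlinarith [mul_nonneg hk.le (mul_self_nonneg (X' (b θ)))]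
  have hGb : ∀ θ, G (b θ) ≠ 0 := fun θ hz ↦ by
    have := hs1 θ
    rw [hz, zero_div] at this
    exact Complex.zero_notMem_slitPlane this
  have hhb : ∀ θ, h (b θ) * G (b θ) = G' (b θ) := by
    intro θ
    have hk := hκid (b θ) (hbd θ).1 (hbd θ).2.1
    rcases hK (b θ) with h1 | h2
    · simp only [hh, hk, h1, if_true, one_mul]; exact hGeq _ h1
    · rw [hh2 _ (by rwa [hk]), hk, div_mul_cancel₀ _ (hGb θ)]
  have hbper : b (2 * Real.pi) = b 0 := by simp [hb, hρ]
  refine no_continuous_log_polar ρ hρc hρpos (by simp [hρ])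
    (fun θ ↦ L (b θ) + L₁ (b θ) + Complex.log (G (b θ) / g₁ (b θ))
      + Complex.log (g₂ (b θ) / G' (b θ))) ?_ (by simp only [hbper]) ?_
  · refine (((hLc.comp hbc).add (hL₁c.comp hbc)).add ?_).add ?_
    · exact ((hGc.comp hbc).div (hg₁c.comp hbc) fun θ ↦ hg₁ne _).clog hs1
    · exact ((hg₂c.comp hbc).div (hGc'.comp hbc) hG'b).clog hs2
  · intro θ
    rw [Complex.exp_add, Complex.exp_add, Complex.exp_add, hL, hL₁,
      Complex.exp_log (Complex.slitPlane_ne_zero (hs1 θ)),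
      Complex.exp_log (Complex.slitPlane_ne_zero (hs2 θ))]
    have e1 : h (b θ) * g₁ (b θ) * (G (b θ) / g₁ (b θ)) * (g₂ (b θ) / G' (b θ)) = g₂ (b θ) := by
      have := hg₁ne (b θ)
      have := hG'b θ
      rw [mul_assoc (h (b θ)), mul_div_cancel₀ _ (hg₁ne (b θ)), hhb]
      field_simp
    rw [e1, Complex.exp_mul_I]
    apply Complex.ext <;> simp [hg₂, hb, ← Complex.ofReal_cos, ← Complex.ofReal_sin]

/-- The standing assumptions on the coefficients, with bounds valid everywhere. -/
structure WEData (T : ℝ) (a e : ℝ → ℝ) (C : ℝ) : Prop where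
  pos : 0 < T
  meas_a : Measurable a
  meas_e : Measurable e
  a_nonneg : ∀ t, 0 ≤ a t
  a_le : ∀ t, a t ≤ C
  e_le : ∀ t, |e t| ≤ C
  int_a : ∫ t in (0:ℝ)..T, a t = T
  int_e : ∫ t in (0:ℝ)..T, e t = 0

/-- `(u, v)` is a `T`-periodic solution of the planar system
`u' = ψ (v - P(t, u))`, `v' = s + e(t) - a(t) Q(t, u) + r(t, u)`. -/
structure IsSys (T : ℝ) (ψ : ℝ → ℝ) (P Q r : ℝ → ℝ → ℝ) (a e : ℝ → ℝ) (s : ℝ)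
    (u v : ℝ → ℝ) : Prop where
  cont_u : Continuous u
  cont_v : Continuous v
  per_u : u T = u 0
  per_v : v T = v 0
  eq_u : ∀ t ∈ Icc 0 T, u t = u 0 + ∫ τ in (0:ℝ)..t, ψ (v τ - P τ (u τ))
  eq_v : ∀ t ∈ Icc 0 T, v t = v 0 + ∫ τ in (0:ℝ)..t, (s + e τ - a τ * Q τ (u τ) + r τ (u τ))

theorem intervalIntegrable_of_bdd {T M : ℝ} {g : ℝ → ℝ} (hm : Measurable g)
    (hb : ∀ t ∈ Icc 0 T, |g t| ≤ M) {x y : ℝ} (hx : x ∈ Icc 0 T) (hy : y ∈ Icc 0 T) :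
    IntervalIntegrable g volume x y := by
  rw [intervalIntegrable_iff]
  refine Measure.integrableOn_of_bounded (M := M) (by simp) hm.aestronglyMeasurable ?_
  refine (ae_restrict_iff' measurableSet_uIoc).2 (Eventually.of_forall fun t ht ↦ hb t ?_)
  exact uIcc_subset_Icc hx hy (uIoc_subset_uIcc ht)

theorem lipschitz_of_integral_eq {T M : ℝ} (hT : 0 ≤ T) {g z : ℝ → ℝ} (hm : Measurable g)
    (hb : ∀ t ∈ Icc 0 T, |g t| ≤ M) (hz : ∀ t ∈ Icc 0 T, z t = z 0 + ∫ τ in (0:ℝ)..t, g τ) :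
    ∀ x ∈ Icc 0 T, ∀ y ∈ Icc 0 T, |z x - z y| ≤ M * |x - y| := by
  intro x hx y hy
  have h0 : (0:ℝ) ∈ Icc 0 T := ⟨le_rfl, hT⟩
  rw [hz x hx, hz y hy, add_sub_add_left_eq_sub, intervalIntegral.integral_interval_sub_left
    (intervalIntegrable_of_bdd hm hb h0 hx) (intervalIntegrable_of_bdd hm hb h0 hy)]
  refine intervalIntegral.norm_integral_le_of_norm_le_const (f := g) fun t ht ↦ hb t ?_
  exact uIcc_subset_Icc hy hx (uIoc_subset_uIcc ht)

/-- A uniformly Lipschitz sequence on `[0, T]`, bounded at `0`, has a convergent subsequence. -/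
theorem exists_subseq_of_lipschitz {T M K : ℝ} (hT : 0 ≤ T) (hM : 0 ≤ M) (x : ℕ → ℝ → ℝ)
    (hx : ∀ n, ∀ s ∈ Icc 0 T, ∀ t ∈ Icc 0 T, |x n s - x n t| ≤ M * |s - t|)
    (h0 : ∀ n, |x n 0| ≤ K) :
    ∃ k : ℕ → ℕ, StrictMono k ∧ ∃ y : ℝ → ℝ, Continuous y ∧
      ∀ t ∈ Icc 0 T, Tendsto (fun n ↦ x (k n) t) atTop (nhds (y t)) := by
  have hlip : ∀ n, LipschitzWith ⟨M, hM⟩ (fun t : Icc 0 T ↦ x n t) := fun n ↦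
    LipschitzWith.of_dist_le_mul fun s t ↦ hx n s s.2 t t.2
  set X : ℕ → BoundedContinuousFunction (Icc 0 T) ℝ := fun n ↦
    BoundedContinuousFunction.mkOfCompact ⟨fun t ↦ x n t, (hlip n).continuous⟩ with hX
  have hcomp : IsCompact (closure (range X)) := by
    refine BoundedContinuousFunction.arzela_ascoli (Icc (-(K + M * T)) (K + M * T)) isCompact_Icc
      _ ?_ ?_
    · rintro _ t ⟨n, rfl⟩
      have h1 := hx n t t.2 0 ⟨le_rfl, hT⟩
      have h2 := abs_sub_abs_le_abs_sub (x n t) (x n 0)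
      have h3 : M * |(t:ℝ) - 0| ≤ M * T := by
        rw [sub_zero, abs_of_nonneg t.2.1]
        exact mul_le_mul_of_nonneg_left t.2.2 hM
      exact abs_le.1 (show |x n t| ≤ _ by linarith [h0 n])
    · refine Metric.equicontinuous_of_continuity_modulus (fun d ↦ M * d) ?_ _ ?_
      · have : Continuous fun d : ℝ ↦ M * d := by fun_prop
        simpa using this.tendsto 0
      · rintro s t ⟨_, n, rfl⟩
        exact (hlip n).dist_le_mul s t
  obtain ⟨y, -, k, hk, hy⟩ := hcomp.tendsto_subseq
    (fun n ↦ subset_closure (mem_range_self (f := X) n))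
  refine ⟨k, hk, IccExtend hT y, y.continuous.Icc_extend', fun t ht ↦ ?_⟩
  rw [IccExtend_of_mem _ _ ht]
  exact (BoundedContinuousFunction.tendsto_iff_tendstoUniformly.1 hy).tendsto_at ⟨t, ht⟩

/-- Approximate solutions of the planar system converge, along a subsequence, to a solution. -/
theorem exists_limit_solution {T C : ℝ} {a e : ℝ → ℝ} (D : WEData T a e C) {ψ : ℝ → ℝ}
    {P Q r : ℝ → ℝ → ℝ} (hψ : Continuous ψ) (hP : Continuous fun x : ℝ × ℝ ↦ P x.1 x.2)
    (hQ : Continuous fun x : ℝ × ℝ ↦ Q x.1 x.2) (hr : Continuous fun x : ℝ × ℝ ↦ r x.1 x.2)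
    {s ε : ℕ → ℝ} {S K M : ℝ} (hs : ∀ n, |s n| ≤ S) (hε : Tendsto ε atTop (nhds 0))
    {u v U V η : ℕ → ℝ → ℝ} (hU : ∀ n, Measurable (U n)) (hV : ∀ n, Measurable (V n))
    (hη : ∀ n, Measurable (η n)) (hu0 : ∀ n, |u n 0| ≤ K) (hv0 : ∀ n, |v n 0| ≤ K)
    (hub : ∀ n, ∀ t ∈ Icc 0 T, |ψ (V n t - P (η n t) (U n t))| ≤ M)
    (hvb : ∀ n, ∀ t ∈ Icc 0 T,
      |s n + e t - a t * Q (η n t) (U n t) + r (η n t) (U n t)| ≤ M)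
    (hu : ∀ n, ∀ t ∈ Icc 0 T, u n t = u n 0 + ∫ τ in (0:ℝ)..t, ψ (V n τ - P (η n τ) (U n τ)))
    (hv : ∀ n, ∀ t ∈ Icc 0 T, v n t = v n 0 +
      ∫ τ in (0:ℝ)..t, (s n + e τ - a τ * Q (η n τ) (U n τ) + r (η n τ) (U n τ)))
    (hUu : ∀ n, ∀ t ∈ Icc 0 T, |U n t - u n t| ≤ ε n)
    (hVv : ∀ n, ∀ t ∈ Icc 0 T, |V n t - v n t| ≤ ε n)
    (hηt : ∀ n, ∀ t ∈ Icc 0 T, |η n t - t| ≤ ε n)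
    (hperu : ∀ n, u n T = u n 0) (hperv : ∀ n, v n T = v n 0) :
    ∃ k : ℕ → ℕ, StrictMono k ∧ ∃ (s' : ℝ) (u' v' : ℝ → ℝ), IsSys T ψ P Q r a e s' u' v' ∧
      Tendsto (fun n ↦ s (k n)) atTop (nhds s') ∧
      ∀ t ∈ Icc 0 T, Tendsto (fun n ↦ u (k n) t) atTop (nhds (u' t)) := by
  have hT := D.pos.le
  have h0 : (0:ℝ) ∈ Icc 0 T := ⟨le_rfl, hT⟩
  have hTT : T ∈ Icc 0 T := ⟨hT, le_rfl⟩
  have hM : 0 ≤ M := (abs_nonneg _).trans (hub 0 0 h0)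
  have mQ : ∀ n, Measurable fun t ↦ Q (η n t) (U n t) := fun n ↦
    hQ.measurable.comp ((hη n).prodMk (hU n))
  have mr : ∀ n, Measurable fun t ↦ r (η n t) (U n t) := fun n ↦
    hr.measurable.comp ((hη n).prodMk (hU n))
  have mP : ∀ n, Measurable fun t ↦ P (η n t) (U n t) := fun n ↦
    hP.measurable.comp ((hη n).prodMk (hU n))
  have mA : ∀ n, Measurable fun t ↦ ψ (V n t - P (η n t) (U n t)) := fun n ↦
    hψ.measurable.comp ((hV n).sub (mP n))
  have mB : ∀ n, Measurable fun t ↦ s n + e t - a t * Q (η n t) (U n t) + r (η n t) (U n t) :=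
    fun n ↦ ((measurable_const.add D.meas_e).sub (D.meas_a.mul (mQ n))).add (mr n)
  obtain ⟨k₁, hk₁, u', hu'c, hu'⟩ := exists_subseq_of_lipschitz hT hM u
    (fun n ↦ lipschitz_of_integral_eq hT (mA n) (hub n) (hu n)) hu0
  obtain ⟨k₂, hk₂, v', hv'c, hv'⟩ := exists_subseq_of_lipschitz hT hM (fun n ↦ v (k₁ n))
    (fun n ↦ lipschitz_of_integral_eq hT (mB _) (hvb _) (hv _)) (fun n ↦ hv0 _)
  obtain ⟨s', -, k₃, hk₃, hs'⟩ := (isCompact_Icc (a := -S) (b := S)).tendsto_subseq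
    (x := fun n ↦ s (k₁ (k₂ n))) (fun n ↦ abs_le.1 (hs _))
  set k : ℕ → ℕ := fun n ↦ k₁ (k₂ (k₃ n)) with hk
  have hkm : StrictMono k := hk₁.comp (hk₂.comp hk₃)
  have tu : ∀ t ∈ Icc 0 T, Tendsto (fun n ↦ u (k n) t) atTop (nhds (u' t)) := fun t ht ↦
    (hu' t ht).comp (hk₂.comp hk₃).tendsto_atTop
  have tv : ∀ t ∈ Icc 0 T, Tendsto (fun n ↦ v (k n) t) atTop (nhds (v' t)) := fun t ht ↦
    (hv' t ht).comp hk₃.tendsto_atTop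
  have hεk := hε.comp hkm.tendsto_atTop
  have near : ∀ {x y : ℕ → ℝ} {l : ℝ}, Tendsto y atTop (nhds l) → (∀ n, |x n - y n| ≤ ε (k n)) →
      Tendsto x atTop (nhds l) := by
    intro x y l hy hxy
    have h1 : Tendsto (fun n ↦ x n - y n) atTop (nhds 0) :=
      squeeze_zero_norm hxy hεk
    simpa using h1.add hy
  have tU : ∀ t ∈ Icc 0 T, Tendsto (fun n ↦ U (k n) t) atTop (nhds (u' t)) := fun t ht ↦
    near (tu t ht) fun n ↦ hUu _ t ht
  have tV : ∀ t ∈ Icc 0 T, Tendsto (fun n ↦ V (k n) t) atTop (nhds (v' t)) := fun t ht ↦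
    near (tv t ht) fun n ↦ hVv _ t ht
  have tη : ∀ t ∈ Icc 0 T, Tendsto (fun n ↦ η (k n) t) atTop (nhds t) := fun t ht ↦
    near tendsto_const_nhds fun n ↦ hηt _ t ht
  have t2 : ∀ {H : ℝ → ℝ → ℝ}, Continuous (fun x : ℝ × ℝ ↦ H x.1 x.2) → ∀ t ∈ Icc 0 T,
      Tendsto (fun n ↦ H (η (k n) t) (U (k n) t)) atTop (nhds (H t (u' t))) := fun hH t ht ↦
    (hH.tendsto (t, u' t)).comp ((tη t ht).prodMk_nhds (tU t ht))
  have dct : ∀ (g : ℕ → ℝ → ℝ) (g' : ℝ → ℝ) (t : ℝ), t ∈ Icc 0 T → (∀ n, Measurable (g n)) →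
      (∀ n, ∀ τ ∈ Icc 0 T, |g n τ| ≤ M) →
      (∀ τ ∈ Icc 0 T, Tendsto (fun n ↦ g n τ) atTop (nhds (g' τ))) →
      Tendsto (fun n ↦ ∫ τ in (0:ℝ)..t, g n τ) atTop (nhds (∫ τ in (0:ℝ)..t, g' τ)) := by
    intro g g' t ht hg hgb hgt
    have hsub : ∀ τ ∈ uIoc 0 t, τ ∈ Icc 0 T := fun τ hτ ↦
      uIcc_subset_Icc h0 ht (uIoc_subset_uIcc hτ)
    exact intervalIntegral.tendsto_integral_filter_of_dominated_convergence (fun _ ↦ M)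
      (Eventually.of_forall fun n ↦ (hg n).aestronglyMeasurable)
      (Eventually.of_forall fun n ↦ Eventually.of_forall fun τ hτ ↦ hgb n τ (hsub τ hτ))
      intervalIntegrable_const (Eventually.of_forall fun τ hτ ↦ hgt τ (hsub τ hτ))
  refine ⟨k, hkm, s', u', v', ⟨hu'c, hv'c, ?_, ?_, ?_, ?_⟩, hs', tu⟩
  · exact tendsto_nhds_unique (tu T hTT) ((tu 0 h0).congr fun n ↦ (hperu _).symm)
  · exact tendsto_nhds_unique (tv T hTT) ((tv 0 h0).congr fun n ↦ (hperv _).symm)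
  · intro t ht
    refine tendsto_nhds_unique (tu t ht) (Tendsto.congr (fun n ↦ (hu (k n) t ht).symm) ?_)
    refine (tu 0 h0).add (dct _ _ t ht (fun n ↦ mA (k n)) (fun n ↦ hub (k n)) fun τ hτ ↦ ?_)
    exact (hψ.tendsto _).comp ((tV τ hτ).sub (t2 hP τ hτ))
  · intro t ht
    refine tendsto_nhds_unique (tv t ht) (Tendsto.congr (fun n ↦ (hv (k n) t ht).symm) ?_)
    refine (tv 0 h0).add (dct _ _ t ht (fun n ↦ mB (k n)) (fun n ↦ hvb (k n)) fun τ hτ ↦ ?_)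
    exact ((hs'.add_const _).sub ((t2 hQ τ hτ).const_mul _)).add (t2 hr τ hτ)

/-- The `i`-th node of the uniform partition of `[0, T]` into `N` intervals. -/
def node (T : ℝ) (N i : ℕ) : ℝ := T * i / N

/-- The index of the partition interval containing `t`. -/
def nodeIdx (T : ℝ) (N : ℕ) (t : ℝ) : ℕ := ⌊N * t / T⌋₊

/-- The explicit Euler scheme with `N` steps for the planar system of `IsSys`. -/
def euler (T : ℝ) (ψ : ℝ → ℝ) (P Q r : ℝ → ℝ → ℝ) (a e : ℝ → ℝ) (s : ℝ) (N : ℕ) (x : ℝ × ℝ) :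
    ℕ → ℝ × ℝ
  | 0 => x
  | i + 1 =>
    ((euler T ψ P Q r a e s N x i).1 + ∫ _ in node T N i..node T N (i + 1),
        ψ ((euler T ψ P Q r a e s N x i).2 - P (node T N i) (euler T ψ P Q r a e s N x i).1),
      (euler T ψ P Q r a e s N x i).2 + ∫ τ in node T N i..node T N (i + 1),
        (s + e τ - a τ * Q (node T N i) (euler T ψ P Q r a e s N x i).1
          + r (node T N i) (euler T ψ P Q r a e s N x i).1))

theorem node_zero (T : ℝ) (N : ℕ) : node T N 0 = 0 := by simp [node]

theorem node_self {T : ℝ} {N : ℕ} (hN : 0 < N) : node T N N = T := by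
  have : (N : ℝ) ≠ 0 := by positivity
  simp [node, this]

theorem node_succ (T : ℝ) (N i : ℕ) : node T N (i + 1) = node T N i + T / N := by
  simp only [node]; push_cast; ring

theorem node_mem {T : ℝ} (hT : 0 ≤ T) {N i : ℕ} (hN : 0 < N) (hi : i ≤ N) :
    node T N i ∈ Icc 0 T := by
  have hN' : (0:ℝ) < N := by exact_mod_cast hN
  have hi' : (i:ℝ) ≤ N := by exact_mod_cast hi
  refine ⟨by unfold node; positivity, ?_⟩
  rw [node, div_le_iff₀ hN']
  exact mul_le_mul_of_nonneg_left hi' hT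

theorem nodeIdx_eq {T : ℝ} (hT : 0 < T) {N i : ℕ} (hN : 0 < N) {t : ℝ}
    (ht : t ∈ Ioo (node T N i) (node T N (i + 1))) : nodeIdx T N t = i := by
  have hN' : (0:ℝ) < N := by exact_mod_cast hN
  obtain ⟨h1, h2⟩ := ht
  rw [node, div_lt_iff₀ hN'] at h1
  rw [node, lt_div_iff₀ hN'] at h2
  push_cast at h2
  unfold nodeIdx
  have h0 : 0 ≤ N * t / T := by
    refine div_nonneg ?_ hT.le
    have : 0 ≤ T * (i:ℝ) := by positivity
    linarith
  rw [Nat.floor_eq_iff h0]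
  exact ⟨by rw [le_div_iff₀ hT]; linarith, by rw [div_lt_iff₀ hT]; linarith⟩

theorem nodeIdx_spec {T : ℝ} (hT : 0 < T) {N : ℕ} (hN : 0 < N) {t : ℝ} (ht : t ∈ Icc 0 T) :
    nodeIdx T N t ≤ N ∧ |node T N (nodeIdx T N t) - t| ≤ T / N := by
  have hN' : (0:ℝ) < N := by exact_mod_cast hN
  have h0 : 0 ≤ N * t / T := by have := ht.1; positivity
  have h1 := Nat.floor_le h0
  have h2 := Nat.lt_floor_add_one (N * t / T)
  change ((nodeIdx T N t : ℕ) : ℝ) ≤ _ at h1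
  change _ < ((nodeIdx T N t : ℕ) : ℝ) + 1 at h2
  refine ⟨?_, ?_⟩
  · have : (N * t / T : ℝ) ≤ N := by
      rw [div_le_iff₀ hT]
      exact mul_le_mul_of_nonneg_left ht.2 hN'.le
    exact_mod_cast h1.trans this
  · rw [le_div_iff₀ hT] at h1
    rw [div_lt_iff₀ hT] at h2
    rw [abs_le, node]
    constructor
    · rw [← sub_nonneg]
      have : T * (nodeIdx T N t : ℝ) / N - t - -(T / N)
          = (((nodeIdx T N t : ℝ) + 1) * T - N * t) / N := by field_simp; ring
      rw [this]
      exact div_nonneg (by linarith) hN'.le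
    · have : T * (nodeIdx T N t : ℝ) / N - t ≤ 0 := by
        rw [sub_nonpos, div_le_iff₀ hN']; linarith
      exact this.trans (by positivity)

theorem measurable_nodeIdx (T : ℝ) (N : ℕ) : Measurable (nodeIdx T N) :=
  Nat.measurable_floor.comp (by fun_prop)

/-- A sequence whose increments are integrals over the partition intervals is the trace at the
nodes of one indefinite integral. -/
theorem eq_integral_of_step {T : ℝ} (hT : 0 < T) {N : ℕ} (hN : 0 < N) (z : ℕ → ℝ)
    (g : ℕ → ℝ → ℝ) (hg : ∀ i x y, IntervalIntegrable (g i) volume x y)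
    (hz : ∀ i, z (i + 1) = z i + ∫ τ in node T N i..node T N (i + 1), g i τ) (i : ℕ) :
    IntervalIntegrable (fun τ ↦ g (nodeIdx T N τ) τ) volume 0 (node T N i) ∧
      z i = z 0 + ∫ τ in (0:ℝ)..node T N i, g (nodeIdx T N τ) τ := by
  induction i with
  | zero => simp [node_zero]
  | succ i ih =>
    have hle : node T N i ≤ node T N (i + 1) := by
      rw [node_succ]; have : 0 ≤ T / N := by positivity
      linarith
    have heq : EqOn (g i) (fun τ ↦ g (nodeIdx T N τ) τ) (Ioo (node T N i) (node T N (i + 1))) :=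
      fun τ hτ ↦ by simp only [nodeIdx_eq hT hN hτ]
    have hint := (hg i (node T N i) (node T N (i + 1))).congr_uIoo (uIoo_of_le hle ▸ heq)
    refine ⟨ih.1.trans hint, ?_⟩
    rw [← intervalIntegral.integral_add_adjacent_intervals ih.1 hint, hz, ih.2,
      intervalIntegral.integral_congr_Ioo_of_le hle heq]
    ring

section

variable {T C : ℝ} {a e ψ : ℝ → ℝ} {P Q r : ℝ → ℝ → ℝ}

theorem WEData.intervalIntegrable_a (D : WEData T a e C) (x y : ℝ) :
    IntervalIntegrable a volume x y := by
  rw [intervalIntegrable_iff]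
  exact Measure.integrableOn_of_bounded (M := C) (by simp) D.meas_a.aestronglyMeasurable
    (Eventually.of_forall fun t ↦ by simpa [abs_of_nonneg (D.a_nonneg t)] using D.a_le t)

theorem WEData.intervalIntegrable_e (D : WEData T a e C) (x y : ℝ) :
    IntervalIntegrable e volume x y := by
  rw [intervalIntegrable_iff]
  exact Measure.integrableOn_of_bounded (M := C) (by simp) D.meas_e.aestronglyMeasurable
    (Eventually.of_forall fun t ↦ D.e_le t)

theorem WEData.intervalIntegrable_rhs (D : WEData T a e C) (s k m x y : ℝ) :
    IntervalIntegrable (fun τ ↦ s + e τ - a τ * k + m) volume x y :=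
  ((intervalIntegrable_const.add (D.intervalIntegrable_e x y)).sub
    ((D.intervalIntegrable_a x y).mul_const k)).add intervalIntegrable_const

theorem WEData.integral_rhs (D : WEData T a e C) (s k m x y : ℝ) :
    ∫ τ in x..y, (s + e τ - a τ * k + m)
      = s * (y - x) + (∫ τ in x..y, e τ) - (∫ τ in x..y, a τ) * k + m * (y - x) := by
  have he := D.intervalIntegrable_e x y
  have ha := D.intervalIntegrable_a x y
  rw [intervalIntegral.integral_add
      ((intervalIntegrable_const.add he).sub (ha.mul_const k)) intervalIntegrable_const,
    intervalIntegral.integral_sub (intervalIntegrable_const.add he) (ha.mul_const k),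
    intervalIntegral.integral_add intervalIntegrable_const he,
    intervalIntegral.integral_mul_const]
  simp [mul_comm]

theorem continuous_euler (D : WEData T a e C) (hψ : Continuous ψ)
    (hP : Continuous fun x : ℝ × ℝ ↦ P x.1 x.2)
    (hQ : Continuous fun x : ℝ × ℝ ↦ Q x.1 x.2) (hr : Continuous fun x : ℝ × ℝ ↦ r x.1 x.2)
    (s : ℝ) (N i : ℕ) : Continuous fun x ↦ euler T ψ P Q r a e s N x i := by
  induction i with
  | zero => exact continuous_id
  | succ i ih =>
    have c2 : ∀ {H : ℝ → ℝ → ℝ}, Continuous (fun x : ℝ × ℝ ↦ H x.1 x.2) →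
        Continuous fun x ↦ H (node T N i) (euler T ψ P Q r a e s N x i).1 := fun hH ↦
      hH.comp (continuous_const.prodMk (continuous_fst.comp ih))
    have hP' := c2 hP
    have hQ' := c2 hQ
    have hr' := c2 hr
    simp only [euler, D.integral_rhs, intervalIntegral.integral_const]
    fun_prop

theorem euler_node (D : WEData T a e C) (s : ℝ) {N : ℕ} (hN : 0 < N) (x : ℝ × ℝ) (i : ℕ) :
    (euler T ψ P Q r a e s N x i).1 = x.1 + ∫ τ in (0:ℝ)..node T N i,
        ψ ((euler T ψ P Q r a e s N x (nodeIdx T N τ)).2 - P (node T N (nodeIdx T N τ))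
          (euler T ψ P Q r a e s N x (nodeIdx T N τ)).1) ∧
    (euler T ψ P Q r a e s N x i).2 = x.2 + ∫ τ in (0:ℝ)..node T N i,
        (s + e τ - a τ * Q (node T N (nodeIdx T N τ))
            (euler T ψ P Q r a e s N x (nodeIdx T N τ)).1
          + r (node T N (nodeIdx T N τ)) (euler T ψ P Q r a e s N x (nodeIdx T N τ)).1) :=
  ⟨(eq_integral_of_step D.pos hN (fun i ↦ (euler T ψ P Q r a e s N x i).1)
      (fun i _ ↦ ψ ((euler T ψ P Q r a e s N x i).2 - P (node T N i)
        (euler T ψ P Q r a e s N x i).1)) (fun _ _ _ ↦ intervalIntegrable_const)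
      (fun _ ↦ rfl) i).2,
    (eq_integral_of_step D.pos hN (fun i ↦ (euler T ψ P Q r a e s N x i).2)
      (fun i τ ↦ s + e τ - a τ * Q (node T N i) (euler T ψ P Q r a e s N x i).1
        + r (node T N i) (euler T ψ P Q r a e s N x i).1)
      (fun _ _ _ ↦ D.intervalIntegrable_rhs _ _ _ _ _) (fun _ ↦ rfl) i).2⟩

/-- `W` bounds the three nonlinearities for `t ∈ [0, T]` and `|z| ≤ R`. -/
def BoundedOn (T R W : ℝ) (P Q r : ℝ → ℝ → ℝ) : Prop :=
  ∀ t ∈ Icc 0 T, ∀ z, |z| ≤ R → |P t z| ≤ W ∧ |Q t z| ≤ W ∧ |r t z| ≤ W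

theorem exists_boundedOn (hP : Continuous fun x : ℝ × ℝ ↦ P x.1 x.2)
    (hQ : Continuous fun x : ℝ × ℝ ↦ Q x.1 x.2) (hr : Continuous fun x : ℝ × ℝ ↦ r x.1 x.2)
    (T R : ℝ) : ∃ W, BoundedOn T R W P Q r := by
  have hK : IsCompact (Icc 0 T ×ˢ Icc (-R) R) := isCompact_Icc.prod isCompact_Icc
  obtain ⟨W₁, h₁⟩ := hK.exists_bound_of_continuousOn hP.continuousOn
  obtain ⟨W₂, h₂⟩ := hK.exists_bound_of_continuousOn hQ.continuousOn
  obtain ⟨W₃, h₃⟩ := hK.exists_bound_of_continuousOn hr.continuousOn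
  refine ⟨max W₁ (max W₂ W₃), fun t ht z hz ↦ ?_⟩
  have hm : (t, z) ∈ Icc 0 T ×ˢ Icc (-R) R := ⟨ht, abs_le.1 hz⟩
  exact ⟨(h₁ _ hm).trans (le_max_left _ _),
    (h₂ _ hm).trans ((le_max_left _ _).trans (le_max_right _ _)),
    (h₃ _ hm).trans ((le_max_right _ _).trans (le_max_right _ _))⟩

theorem WEData.abs_rhs_le (D : WEData T a e C) {s S k m W : ℝ} (hs : |s| ≤ S) (hk : |k| ≤ W)
    (hm : |m| ≤ W) (t : ℝ) : |s + e t - a t * k + m| ≤ S + C + C * W + W := by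
  have h1 : |a t * k| ≤ C * W := by
    rw [abs_mul, abs_of_nonneg (D.a_nonneg t)]
    exact mul_le_mul (D.a_le t) hk (abs_nonneg _) ((D.a_nonneg t).trans (D.a_le t))
  have h2 := D.e_le t
  rw [abs_le] at *
  constructor <;> linarith

theorem abs_euler_fst_sub_le (D : WEData T a e C) {Ψ : ℝ} (hΨ : ∀ y, |ψ y| ≤ Ψ) (s : ℝ) {N : ℕ}
    (hN : 0 < N) (x : ℝ × ℝ) {i : ℕ} (hi : i ≤ N) :
    |(euler T ψ P Q r a e s N x i).1 - x.1| ≤ Ψ * T := by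
  rw [(euler_node D s hN x i).1, add_sub_cancel_left, ← Real.norm_eq_abs]
  refine (intervalIntegral.norm_integral_le_of_norm_le_const (C := Ψ) fun τ _ ↦ hΨ _).trans ?_
  have hm := node_mem D.pos.le hN hi
  rw [sub_zero, abs_of_nonneg hm.1]
  exact mul_le_mul_of_nonneg_left hm.2 ((abs_nonneg _).trans (hΨ 0))

theorem abs_euler_rhs_le (D : WEData T a e C) {Ψ R W S s : ℝ} (hΨ : ∀ y, |ψ y| ≤ Ψ)
    (hW : BoundedOn T (R + Ψ * T) W P Q r) (hs : |s| ≤ S) {N : ℕ} (hN : 0 < N) {x : ℝ × ℝ}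
    (hx : |x.1| ≤ R) {i : ℕ} (hi : i ≤ N) (t : ℝ) :
    |s + e t - a t * Q (node T N i) (euler T ψ P Q r a e s N x i).1
      + r (node T N i) (euler T ψ P Q r a e s N x i).1| ≤ S + C + C * W + W := by
  have h1 := abs_euler_fst_sub_le (P := P) (Q := Q) (r := r) D hΨ s hN x hi
  have h2 := abs_sub_abs_le_abs_sub (euler T ψ P Q r a e s N x i).1 x.1
  obtain ⟨-, h3, h4⟩ := hW _ (node_mem D.pos.le hN hi) (euler T ψ P Q r a e s N x i).1
    (by linarith)
  exact D.abs_rhs_le hs h3 h4 t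

theorem abs_euler_snd_sub_le (D : WEData T a e C) {Ψ R W S s : ℝ} (hΨ : ∀ y, |ψ y| ≤ Ψ)
    (hW : BoundedOn T (R + Ψ * T) W P Q r) (hs : |s| ≤ S) {N : ℕ} (hN : 0 < N) {x : ℝ × ℝ}
    (hx : |x.1| ≤ R) {i : ℕ} (hi : i ≤ N) :
    |(euler T ψ P Q r a e s N x i).2 - x.2| ≤ (S + C + C * W + W) * T := by
  have hm := node_mem D.pos.le hN hi
  rw [(euler_node D s hN x i).2, add_sub_cancel_left, ← Real.norm_eq_abs]
  refine (intervalIntegral.norm_integral_le_of_norm_le_const (C := S + C + C * W + W)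
    fun τ hτ ↦ ?_).trans ?_
  · have hτ' : τ ∈ Icc 0 T := uIcc_subset_Icc ⟨le_rfl, D.pos.le⟩ hm (uIoc_subset_uIcc hτ)
    exact abs_euler_rhs_le D hΨ hW hs hN hx (nodeIdx_spec D.pos hN hτ').1 τ
  · rw [sub_zero, abs_of_nonneg hm.1]
    exact mul_le_mul_of_nonneg_left hm.2
      ((abs_nonneg _).trans (abs_euler_rhs_le D hΨ hW hs hN hx hi 0))

/-- A fixed point of the Euler map starting far up (down) in the second variable does not exist:
the first variable increases (decreases). -/
theorem euler_fst_sign (D : WEData T a e C) {Ψ R W S s B : ℝ} (hΨ : ∀ y, |ψ y| ≤ Ψ)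
    (hψ : Continuous ψ) (hψpos : ∀ y, 0 < y → 0 < ψ y) (hψneg : ∀ y, y < 0 → ψ y < 0)
    (hW : BoundedOn T (R + Ψ * T) W P Q r) (hs : |s| ≤ S)
    (hB : (S + C + C * W + W) * T + W < B) {N : ℕ} (hN : 0 < N) {x : ℝ × ℝ}
    (hx : |x.1| ≤ R) (hx2 : |x.2| = B) :
    0 < x.2 * ((euler T ψ P Q r a e s N x N).1 - x.1) := by
  have key : ∀ i ≤ N, |((euler T ψ P Q r a e s N x i).2 - P (node T N i)
      (euler T ψ P Q r a e s N x i).1) - x.2| < B := by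
    intro i hi
    have h1 := abs_euler_fst_sub_le (P := P) (Q := Q) (r := r) D hΨ s hN x hi
    have h2 := abs_sub_abs_le_abs_sub (euler T ψ P Q r a e s N x i).1 x.1
    obtain ⟨h3, -, -⟩ := hW _ (node_mem D.pos.le hN hi) (euler T ψ P Q r a e s N x i).1
      (by linarith)
    have h4 := abs_euler_snd_sub_le D hΨ hW hs hN hx hi
    rw [abs_le] at h3 h4
    rw [abs_lt]
    constructor <;> linarith
  have hint : IntervalIntegrable (fun τ ↦ ψ ((euler T ψ P Q r a e s N x (nodeIdx T N τ)).2 -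
      P (node T N (nodeIdx T N τ)) (euler T ψ P Q r a e s N x (nodeIdx T N τ)).1)) volume 0 T := by
    refine intervalIntegrable_of_bdd (T := T) (M := Ψ) ?_ (fun _ _ ↦ hΨ _)
      ⟨le_rfl, D.pos.le⟩ ⟨D.pos.le, le_rfl⟩
    exact hψ.measurable.comp ((measurable_from_top (f := fun i : ℕ ↦
      (euler T ψ P Q r a e s N x i).2 - P (node T N i) (euler T ψ P Q r a e s N x i).1)).comp
      (measurable_nodeIdx T N))
  rw [(euler_node D s hN x N).1, node_self hN, add_sub_cancel_left]
  have hB0 : |x.2| = B := hx2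
  rcases abs_choice x.2 with h | h
  · have hpos : 0 < ∫ τ in (0:ℝ)..T, ψ ((euler T ψ P Q r a e s N x (nodeIdx T N τ)).2 -
      P (node T N (nodeIdx T N τ)) (euler T ψ P Q r a e s N x (nodeIdx T N τ)).1) := by
      refine intervalIntegral.intervalIntegral_pos_of_pos_on hint (fun τ hτ ↦ hψpos _ ?_) D.pos
      have := (abs_lt.1 (key _ (nodeIdx_spec D.pos hN (Ioo_subset_Icc_self hτ)).1)).1
      linarith
    have : 0 < x.2 := by
      have := key 0 (Nat.zero_le _)
      have := (abs_nonneg _).trans_lt this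
      linarith
    positivity
  · have hpos : 0 < ∫ τ in (0:ℝ)..T, -ψ ((euler T ψ P Q r a e s N x (nodeIdx T N τ)).2 -
      P (node T N (nodeIdx T N τ)) (euler T ψ P Q r a e s N x (nodeIdx T N τ)).1) := by
      refine intervalIntegral.intervalIntegral_pos_of_pos_on hint.neg
        (fun τ hτ ↦ neg_pos.2 (hψneg _ ?_)) D.pos
      have := (abs_lt.1 (key _ (nodeIdx_spec D.pos hN (Ioo_subset_Icc_self hτ)).1)).2
      linarith
    have : x.2 < 0 := by
      have := key 0 (Nat.zero_le _)
      have := (abs_nonneg _).trans_lt this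
      linarith
    rw [intervalIntegral.integral_neg] at hpos
    exact mul_pos_of_neg_of_neg this (by linarith)

theorem euler_snd_le (D : WEData T a e C) {k m : ℝ} (s : ℝ) {N : ℕ} (hN : 0 < N) (x : ℝ × ℝ)
    (hQ : ∀ i ≤ N, k ≤ Q (node T N i) (euler T ψ P Q r a e s N x i).1)
    (hr : ∀ i ≤ N, r (node T N i) (euler T ψ P Q r a e s N x i).1 ≤ m) :
    (euler T ψ P Q r a e s N x N).2 - x.2 ≤ (s - k + m) * T := by
  obtain ⟨hint, -⟩ := eq_integral_of_step D.pos hN (fun i ↦ (euler T ψ P Q r a e s N x i).2)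
      (fun i τ ↦ s + e τ - a τ * Q (node T N i) (euler T ψ P Q r a e s N x i).1
        + r (node T N i) (euler T ψ P Q r a e s N x i).1)
      (fun _ _ _ ↦ D.intervalIntegrable_rhs _ _ _ _ _) (fun _ ↦ rfl) N
  rw [(euler_node D s hN x N).2, add_sub_cancel_left]
  rw [node_self hN] at *
  refine (intervalIntegral.integral_mono_on D.pos.le hint (D.intervalIntegrable_rhs s k m 0 T)
    fun τ hτ ↦ ?_).trans_eq ?_
  · have hi := (nodeIdx_spec D.pos hN hτ).1
    have h1 := mul_le_mul_of_nonneg_left (hQ _ hi) (D.a_nonneg τ)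
    have h2 := hr _ hi
    linarith
  · rw [D.integral_rhs, D.int_a, D.int_e]
    ring

theorem le_euler_snd (D : WEData T a e C) {k m : ℝ} (s : ℝ) {N : ℕ} (hN : 0 < N) (x : ℝ × ℝ)
    (hQ : ∀ i ≤ N, Q (node T N i) (euler T ψ P Q r a e s N x i).1 ≤ k)
    (hr : ∀ i ≤ N, m ≤ r (node T N i) (euler T ψ P Q r a e s N x i).1) :
    (s - k + m) * T ≤ (euler T ψ P Q r a e s N x N).2 - x.2 := by
  obtain ⟨hint, -⟩ := eq_integral_of_step D.pos hN (fun i ↦ (euler T ψ P Q r a e s N x i).2)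
      (fun i τ ↦ s + e τ - a τ * Q (node T N i) (euler T ψ P Q r a e s N x i).1
        + r (node T N i) (euler T ψ P Q r a e s N x i).1)
      (fun _ _ _ ↦ D.intervalIntegrable_rhs _ _ _ _ _) (fun _ ↦ rfl) N
  rw [(euler_node D s hN x N).2, add_sub_cancel_left]
  rw [node_self hN] at *
  refine Eq.trans_le ?_ (intervalIntegral.integral_mono_on D.pos.le
    (D.intervalIntegrable_rhs s k m 0 T) hint fun τ hτ ↦ ?_)
  · rw [D.integral_rhs, D.int_a, D.int_e]
    ring
  · have hi := (nodeIdx_spec D.pos hN hτ).1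
    have h1 := mul_le_mul_of_nonneg_left (hQ _ hi) (D.a_nonneg τ)
    have h2 := hr _ hi
    linarith

/-- Fixed points of the Euler maps with finer and finer partitions accumulate at a periodic
solution, and a lower bound at some node is inherited by the limit. -/
theorem exists_solution_of_euler (D : WEData T a e C) {Ψ R B s : ℝ} (hψ : Continuous ψ)
    (hP : Continuous fun x : ℝ × ℝ ↦ P x.1 x.2)
    (hQ : Continuous fun x : ℝ × ℝ ↦ Q x.1 x.2) (hr : Continuous fun x : ℝ × ℝ ↦ r x.1 x.2)
    (hΨ : ∀ y, |ψ y| ≤ Ψ) {b : ℝ → ℝ} (hb : Continuous b) {N i : ℕ → ℕ} {x : ℕ → ℝ × ℝ}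
    (hN : ∀ n, n < N n) (hi : ∀ n, i n < N n) (hx1 : ∀ n, |(x n).1| ≤ R)
    (hx2 : ∀ n, |(x n).2| ≤ B) (hfix : ∀ n, euler T ψ P Q r a e s (N n) (x n) (N n) = x n)
    (hbi : ∀ n, b (node T (N n) (i n)) ≤ (euler T ψ P Q r a e s (N n) (x n) (i n)).1) :
    ∃ u v, IsSys T ψ P Q r a e s u v ∧ ∃ t ∈ Icc 0 T, b t ≤ u t := by
  have hT := D.pos.le
  have h0 : (0:ℝ) ∈ Icc 0 T := ⟨le_rfl, hT⟩
  have hN0 : ∀ n, 0 < N n := fun n ↦ (Nat.zero_le n).trans_lt (hN n)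
  obtain ⟨W, hW⟩ := exists_boundedOn hP hQ hr T (R + Ψ * T)
  set M : ℝ := max Ψ (|s| + C + C * W + W) with hM
  have hM0 : 0 ≤ M := ((abs_nonneg _).trans (hΨ 0)).trans (le_max_left _ _)
  set E : ℕ → ℕ → ℝ × ℝ := fun n i ↦ euler T ψ P Q r a e s (N n) (x n) i with hE
  set U : ℕ → ℝ → ℝ := fun n t ↦ (E n (nodeIdx T (N n) t)).1 with hU
  set V : ℕ → ℝ → ℝ := fun n t ↦ (E n (nodeIdx T (N n) t)).2 with hV
  set η : ℕ → ℝ → ℝ := fun n t ↦ node T (N n) (nodeIdx T (N n) t) with hη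
  have meas : ∀ (n : ℕ) (g : ℕ → ℝ), Measurable fun t ↦ g (nodeIdx T (N n) t) := fun n g ↦
    (measurable_from_top (f := g)).comp (measurable_nodeIdx T (N n))
  have mU : ∀ n, Measurable (U n) := fun n ↦ meas n fun i ↦ (E n i).1
  have mV : ∀ n, Measurable (V n) := fun n ↦ meas n fun i ↦ (E n i).2
  have mη : ∀ n, Measurable (η n) := fun n ↦ meas n fun i ↦ node T (N n) i
  have mA : ∀ n, Measurable fun t ↦ ψ (V n t - P (η n t) (U n t)) := fun n ↦
    meas n fun i ↦ ψ ((E n i).2 - P (node T (N n) i) (E n i).1)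
  have mB : ∀ n, Measurable fun t ↦ s + e t - a t * Q (η n t) (U n t) + r (η n t) (U n t) :=
    fun n ↦ ((measurable_const.add D.meas_e).sub (D.meas_a.mul
      (meas n fun i ↦ Q (node T (N n) i) (E n i).1))).add
      (meas n fun i ↦ r (node T (N n) i) (E n i).1)
  have hA : ∀ n, ∀ t ∈ Icc 0 T, |ψ (V n t - P (η n t) (U n t))| ≤ M := fun n t _ ↦
    (hΨ _).trans (le_max_left _ _)
  have hB : ∀ n, ∀ t ∈ Icc 0 T,
      |s + e t - a t * Q (η n t) (U n t) + r (η n t) (U n t)| ≤ M := fun n t ht ↦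
    (abs_euler_rhs_le D hΨ hW le_rfl (hN0 n) (hx1 n) (nodeIdx_spec D.pos (hN0 n) ht).1 t).trans
      (le_max_right _ _)
  set u : ℕ → ℝ → ℝ := fun n t ↦ (x n).1 + ∫ τ in (0:ℝ)..t, ψ (V n τ - P (η n τ) (U n τ)) with hu
  set v : ℕ → ℝ → ℝ := fun n t ↦ (x n).2 +
    ∫ τ in (0:ℝ)..t, (s + e τ - a τ * Q (η n τ) (U n τ) + r (η n τ) (U n τ)) with hv
  have hu0 : ∀ n, u n 0 = (x n).1 := fun n ↦ by simp [hu]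
  have hv0 : ∀ n, v n 0 = (x n).2 := fun n ↦ by simp [hv]
  have hun : ∀ n i, u n (node T (N n) i) = (E n i).1 := fun n i ↦
    (euler_node D s (hN0 n) (x n) i).1.symm
  have hvn : ∀ n i, v n (node T (N n) i) = (E n i).2 := fun n i ↦
    (euler_node D s (hN0 n) (x n) i).2.symm
  have hu' : ∀ n, ∀ t ∈ Icc 0 T,
      u n t = u n 0 + ∫ τ in (0:ℝ)..t, ψ (V n τ - P (η n τ) (U n τ)) := fun n t _ ↦ by rw [hu0]
  have hv' : ∀ n, ∀ t ∈ Icc 0 T, v n t = v n 0 +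
      ∫ τ in (0:ℝ)..t, (s + e τ - a τ * Q (η n τ) (U n τ) + r (η n τ) (U n τ)) := fun n t _ ↦ by
    rw [hv0]
  have lu := fun n ↦ lipschitz_of_integral_eq hT (mA n) (hA n) (hu' n)
  have lv := fun n ↦ lipschitz_of_integral_eq hT (mB n) (hB n) (hv' n)
  have hηm : ∀ n, ∀ t ∈ Icc 0 T, η n t ∈ Icc 0 T := fun n t ht ↦
    node_mem hT (hN0 n) (nodeIdx_spec D.pos (hN0 n) ht).1
  have hNn : ∀ n, T / N n ≤ T / ((n:ℝ) + 1) := fun n ↦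
    div_le_div_of_nonneg_left hT (by positivity) (by exact_mod_cast hN n)
  have hηt : ∀ n, ∀ t ∈ Icc 0 T, |η n t - t| ≤ T / ((n:ℝ) + 1) := fun n t ht ↦
    (nodeIdx_spec D.pos (hN0 n) ht).2.trans (hNn n)
  set ε : ℕ → ℝ := fun n ↦ (M + 1) * (T / ((n:ℝ) + 1)) with hε
  have hT1 : ∀ n : ℕ, 0 ≤ T / ((n:ℝ) + 1) := fun n ↦ by positivity
  have hεt : Tendsto ε atTop (nhds 0) := by
    have := (tendsto_one_div_add_atTop_nhds_zero_nat (𝕜 := ℝ)).const_mul ((M + 1) * T)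
    rw [mul_zero] at this
    exact this.congr fun n ↦ by simp only [hε]; ring
  have hεM : ∀ n : ℕ, M * (T / ((n:ℝ) + 1)) ≤ ε n := fun n ↦
    mul_le_mul_of_nonneg_right (by linarith) (hT1 n)
  obtain ⟨k, hk, s', u', v', hsys, hs', hlim⟩ := exists_limit_solution D hψ hP hQ hr
    (s := fun _ ↦ s) (ε := ε) (S := |s|) (K := max R B) (M := M) (u := u) (v := v) (U := U)
    (V := V) (η := η) (fun _ ↦ le_rfl) hεt mU mV mη
    (fun n ↦ by rw [hu0]; exact (hx1 n).trans (le_max_left _ _))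
    (fun n ↦ by rw [hv0]; exact (hx2 n).trans (le_max_right _ _)) hA hB hu' hv'
    (fun n t ht ↦ by
      have h1 := lu n _ (hηm n t ht) t ht
      have h2 := hun n (nodeIdx T (N n) t)
      change u n (η n t) = U n t at h2
      rw [← h2]
      exact h1.trans ((mul_le_mul_of_nonneg_left (hηt n t ht) hM0).trans (hεM n)))
    (fun n t ht ↦ by
      have h1 := lv n _ (hηm n t ht) t ht
      have h2 := hvn n (nodeIdx T (N n) t)
      change v n (η n t) = V n t at h2
      rw [← h2]
      exact h1.trans ((mul_le_mul_of_nonneg_left (hηt n t ht) hM0).trans (hεM n)))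
    (fun n t ht ↦ (hηt n t ht).trans (le_mul_of_one_le_left (hT1 n) (by linarith)))
    (fun n ↦ by
      have h := hun n (N n)
      rw [node_self (hN0 n)] at h
      rw [h, hu0, hE]; exact congrArg Prod.fst (hfix n))
    (fun n ↦ by
      have h := hvn n (N n)
      rw [node_self (hN0 n)] at h
      rw [h, hv0, hE]; exact congrArg Prod.snd (hfix n))
  obtain rfl : s = s' := tendsto_nhds_unique tendsto_const_nhds hs'
  have hnm : ∀ n, node T (N n) (i n) ∈ Icc 0 T := fun n ↦ node_mem hT (hN0 n) (hi n).le
  obtain ⟨t, ht, j, hj, hjt⟩ := isCompact_Icc.tendsto_subseq (fun n ↦ hnm (k n))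
  refine ⟨u', v', hsys, t, ht, ?_⟩
  have h1 := (hlim t ht).comp hj.tendsto_atTop
  have h2 : Tendsto (fun n ↦ M * |node T (N (k (j n))) (i (k (j n))) - t|) atTop (nhds 0) := by
    have := ((hjt.sub_const t).abs).const_mul M
    simpa using this
  have h3 := h1.add h2
  rw [add_zero] at h3
  refine le_of_tendsto_of_tendsto' ((hb.tendsto t).comp hjt) h3 fun n ↦ ?_
  have h4 := lu (k (j n)) _ (hnm (k (j n))) t ht
  have h5 := hbi (k (j n))
  have h6 := hun (k (j n)) (i (k (j n)))
  have h7 := le_abs_self (u (k (j n)) (node T (N (k (j n))) (i (k (j n)))) - u (k (j n)) t)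
  simp only [hE] at h6
  simp only [Function.comp_apply]
  linarith

end

/-- The function `ψ` made constant outside `[-B, B]`. -/
def trunc (ψ : ℝ → ℝ) (B y : ℝ) : ℝ := ψ (max (-B) (min B y))

theorem trunc_of_abs_le (ψ : ℝ → ℝ) {B y : ℝ} (h : |y| ≤ B) : trunc ψ B y = ψ y := by
  rw [abs_le] at h
  rw [trunc, min_eq_right h.2, max_eq_right h.1]

theorem continuous_trunc {ψ : ℝ → ℝ} (hψ : Continuous ψ) (B : ℝ) : Continuous (trunc ψ B) := by
  unfold trunc
  fun_prop

theorem trunc_lt_trunc {ψ : ℝ → ℝ} (hψ : StrictMono ψ) {B x y : ℝ} (hxy : x < y)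
    (h : |x| < B ∨ |y| < B) : trunc ψ B x < trunc ψ B y := by
  apply hψ
  rcases h with h | h <;> rw [abs_lt] at h
  · rw [min_eq_right h.2.le, max_eq_right h.1.le]
    exact lt_max_of_lt_right (lt_min h.2 hxy)
  · rw [min_eq_right h.2.le, max_eq_right h.1.le]
    exact max_lt h.1 ((min_le_right _ _).trans_lt hxy)

section

variable {ψ : ℝ → ℝ}

theorem abs_trunc_le_of_abs_le (hψ : StrictMono ψ) {B K y : ℝ} (hB : 0 ≤ B) (hy : |y| ≤ K) :
    |trunc ψ B y| ≤ |ψ K| + |ψ (-K)| := by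
  rw [abs_le] at hy
  have h1 : trunc ψ B y ≤ ψ K := hψ.monotone (max_le (by linarith) ((min_le_right _ _).trans hy.2))
  have h2 : ψ (-K) ≤ trunc ψ B y := hψ.monotone (le_max_of_le_right (le_min (by linarith) hy.1))
  rw [abs_le]
  constructor <;> linarith [neg_abs_le (ψ (-K)), le_abs_self (ψ K), abs_nonneg (ψ K),
    abs_nonneg (ψ (-K))]

theorem abs_trunc_le (hψ : StrictMono ψ) {B : ℝ} (hB : 0 ≤ B) (y : ℝ) :
    |trunc ψ B y| ≤ |ψ B| + |ψ (-B)| := by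
  have h : trunc ψ B y = trunc ψ B (max (-B) (min B y)) := by
    rw [trunc_of_abs_le ψ (y := max (-B) (min B y))
      (abs_le.2 ⟨le_max_left _ _, max_le (by linarith) (min_le_left _ _)⟩), trunc]
  rw [h]
  exact abs_trunc_le_of_abs_le hψ hB
    (abs_le.2 ⟨le_max_left _ _, max_le (by linarith) (min_le_left _ _)⟩)

theorem trunc_zero (hψ0 : ψ 0 = 0) {B : ℝ} (hB : 0 < B) : trunc ψ B 0 = 0 := by
  rw [trunc_of_abs_le _ (by simpa using hB.le), hψ0]

theorem trunc_pos (hψ : StrictMono ψ) (hψ0 : ψ 0 = 0) {B : ℝ} (hB : 0 < B) {y : ℝ} (hy : 0 < y) :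
    0 < trunc ψ B y := by
  rw [← trunc_zero hψ0 hB]
  exact trunc_lt_trunc hψ hy (Or.inl (by simpa using hB))

theorem trunc_neg (hψ : StrictMono ψ) (hψ0 : ψ 0 = 0) {B : ℝ} (hB : 0 < B) {y : ℝ} (hy : y < 0) :
    trunc ψ B y < 0 := by
  rw [← trunc_zero hψ0 hB]
  exact trunc_lt_trunc hψ hy (Or.inr (by simpa using hB))

theorem mul_abs_trunc_le (hψ : StrictMono ψ) (hψ0 : ψ 0 = 0) {B : ℝ} (hB : 0 < B)
    {K : ℝ} (hK : 0 ≤ K) (y : ℝ) :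
    K * |trunc ψ B y| ≤ y * trunc ψ B y + K * (|ψ K| + |ψ (-K)|) := by
  have hn : y * trunc ψ B y = |y| * |trunc ψ B y| := by
    rw [← abs_mul, abs_of_nonneg]
    rcases lt_trichotomy y 0 with h | h | h
    · exact mul_nonneg_of_nonpos_of_nonpos h.le (trunc_neg hψ hψ0 hB h).le
    · simp [h]
    · exact mul_nonneg h.le (trunc_pos hψ hψ0 hB h).le
  rw [hn]
  rcases le_total |y| K with h | h
  · have h1 := mul_le_mul_of_nonneg_left (abs_trunc_le_of_abs_le hψ hB.le h) hK
    have h2 : 0 ≤ |y| * |trunc ψ B y| := by positivity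
    linarith
  · have h1 := mul_le_mul_of_nonneg_right h (abs_nonneg (trunc ψ B y))
    have h2 : 0 ≤ K * (|ψ K| + |ψ (-K)|) := by positivity
    linarith

end

theorem abs_integral_le_integral_abs_of_mem {T x y : ℝ} {g : ℝ → ℝ}
    (hg : IntervalIntegrable g volume 0 T) (hx : x ∈ Icc 0 T) (hy : y ∈ Icc 0 T) :
    |∫ τ in x..y, g τ| ≤ ∫ τ in (0:ℝ)..T, |g τ| := by
  have hT : 0 ≤ T := hx.1.trans hx.2
  have h1 : |∫ τ in x..y, g τ| ≤ ∫ τ in uIoc x y, |g τ| :=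
    intervalIntegral.norm_integral_le_integral_norm_uIoc (f := g)
  refine h1.trans ?_
  rw [intervalIntegral.integral_of_le hT]
  have h2 := hg.abs
  rw [intervalIntegrable_iff, uIoc_of_le hT] at h2
  refine setIntegral_mono_set h2 (Eventually.of_forall fun _ ↦ abs_nonneg _) ?_
  refine LE.le.eventuallyLE fun t ht ↦ ?_
  rw [uIoc, mem_Ioc] at ht
  exact ⟨(le_min hx.1 hy.1).trans_lt ht.1, ht.2.trans (max_le hx.2 hy.2)⟩

namespace IsSys

variable {T C s : ℝ} {a e ψ : ℝ → ℝ} {P Q r : ℝ → ℝ → ℝ} {u v : ℝ → ℝ}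

theorem congr {ψ' : ℝ → ℝ} {P' Q' r' : ℝ → ℝ → ℝ} {a' e' : ℝ → ℝ} {s' : ℝ}
    (h : IsSys T ψ P Q r a e s u v)
    (hψ : ∀ t ∈ Icc 0 T, ψ (v t - P t (u t)) = ψ' (v t - P' t (u t)))
    (hQ : ∀ t ∈ Icc 0 T, s + e t - a t * Q t (u t) + r t (u t)
      = s' + e' t - a' t * Q' t (u t) + r' t (u t)) :
    IsSys T ψ' P' Q' r' a' e' s' u v where
  cont_u := h.cont_u
  cont_v := h.cont_v
  per_u := h.per_u
  per_v := h.per_v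
  eq_u t ht := by
    rw [h.eq_u t ht]
    congr 1
    refine intervalIntegral.integral_congr fun τ hτ ↦ hψ τ ?_
    exact uIcc_subset_Icc ⟨le_rfl, ht.1.trans ht.2⟩ ht hτ
  eq_v t ht := by
    rw [h.eq_v t ht]
    congr 1
    refine intervalIntegral.integral_congr fun τ hτ ↦ hQ τ ?_
    exact uIcc_subset_Icc ⟨le_rfl, ht.1.trans ht.2⟩ ht hτ

end IsSys

theorem hasDerivAt_of_eq_integral {T : ℝ} {u g : ℝ → ℝ} (hg : Continuous g)
    (h : ∀ t ∈ Icc 0 T, u t = u 0 + ∫ τ in (0:ℝ)..t, g τ) {t : ℝ} (ht : t ∈ Ioo 0 T) :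
    HasDerivAt u (g t) t := by
  have h1 : HasDerivAt (fun t ↦ u 0 + ∫ τ in (0:ℝ)..t, g τ) (g t) t :=
    (intervalIntegral.integral_hasDerivAt_right (hg.intervalIntegrable _ _)
      (hg.stronglyMeasurableAtFilter _ _) hg.continuousAt).const_add _
  refine h1.congr_of_eventuallyEq ?_
  filter_upwards [Ioo_mem_nhds ht.1 ht.2] with x hx using h x (Ioo_subset_Icc_self hx)

theorem integral_comp_mul_eq {T : ℝ} {u g F : ℝ → ℝ} (hu : Continuous u)
    (hg : Continuous g) (hF : Continuous F)
    (h : ∀ t ∈ Icc 0 T, u t = u 0 + ∫ τ in (0:ℝ)..t, g τ) {t : ℝ} (ht : t ∈ Icc 0 T) :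
    ∫ τ in (0:ℝ)..t, F (u τ) * g τ = (∫ τ in (0:ℝ)..u t, F τ) - ∫ τ in (0:ℝ)..u 0, F τ := by
  have hd : ∀ x, HasDerivAt (fun x ↦ ∫ τ in (0:ℝ)..x, F τ) (F x) x := fun x ↦
    intervalIntegral.integral_hasDerivAt_right (hF.intervalIntegrable _ _)
      (hF.stronglyMeasurableAtFilter _ _) hF.continuousAt
  have hGc : Continuous fun x ↦ ∫ τ in (0:ℝ)..x, F τ :=
    continuous_iff_continuousAt.2 fun x ↦ (hd x).continuousAt
  exact intervalIntegral.integral_eq_sub_of_hasDerivAt_of_le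
    (f := fun t ↦ ∫ τ in (0:ℝ)..u t, F τ) ht.1 (hGc.comp hu).continuousOn
    (fun τ hτ ↦ (hd (u τ)).comp τ
      (hasDerivAt_of_eq_integral hg h ⟨hτ.1, hτ.2.trans_le ht.2⟩))
    (((hF.comp hu).mul hg).intervalIntegrable _ _)

theorem integral_comp_mul_eq_zero {T : ℝ} (hT : 0 ≤ T) {u g F : ℝ → ℝ} (hu : Continuous u)
    (hg : Continuous g) (hF : Continuous F)
    (h : ∀ t ∈ Icc 0 T, u t = u 0 + ∫ τ in (0:ℝ)..t, g τ) (hper : u T = u 0) :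
    ∫ t in (0:ℝ)..T, F (u t) * g t = 0 := by
  rw [integral_comp_mul_eq hu hg hF h ⟨hT, le_rfl⟩, hper, sub_self]

section

variable {T C : ℝ} {a e ψ F q : ℝ → ℝ}

theorem WEData.integral_mul_eq {s : ℝ} (D : WEData T a e C) (hq : Continuous q) {P : ℝ → ℝ → ℝ}
    {u v : ℝ → ℝ}
    (h : IsSys T ψ P (fun _ x ↦ q x) (fun _ _ ↦ 0) a e s u v) :
    IntervalIntegrable (fun t ↦ a t * q (u t)) volume 0 T ∧
      ∫ t in (0:ℝ)..T, a t * q (u t) = s * T := by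
  have hi : IntervalIntegrable (fun t ↦ a t * q (u t)) volume 0 T :=
    (D.intervalIntegrable_a 0 T).mul_continuousOn (hq.comp h.cont_u).continuousOn
  refine ⟨hi, ?_⟩
  have h1 := h.eq_v T ⟨D.pos.le, le_rfl⟩
  simp only [add_zero] at h1
  rw [h.per_v, intervalIntegral.integral_sub
    (intervalIntegrable_const.add (D.intervalIntegrable_e 0 T)) hi,
    intervalIntegral.integral_add intervalIntegrable_const (D.intervalIntegrable_e 0 T),
    D.int_e] at h1
  simp at h1
  linarith

theorem WEData.exists_le_of_isSys {s k : ℝ} (D : WEData T a e C) (hq : Continuous q)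
    {P : ℝ → ℝ → ℝ} {u v : ℝ → ℝ}
    (h : IsSys T ψ P (fun _ x ↦ q x) (fun _ _ ↦ 0) a e s u v)
    (hk : ∀ t ∈ Icc 0 T, k ≤ q (u t)) : k ≤ s := by
  obtain ⟨hi, h1⟩ := D.integral_mul_eq hq h
  have h2 := intervalIntegral.integral_mono_on D.pos.le
    ((D.intervalIntegrable_a 0 T).mul_const k) hi
    fun t ht ↦ mul_le_mul_of_nonneg_left (hk t ht) (D.a_nonneg t)
  rw [h1, intervalIntegral.integral_mul_const, D.int_a, mul_comm s] at h2
  exact le_of_mul_le_mul_left h2 D.pos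

theorem exists_bounds_of_tendsto (hq : Continuous q) (ht : Tendsto q atTop atTop)
    (hb : Tendsto q atBot atTop) :
    (∃ Q₀, 0 ≤ Q₀ ∧ ∀ x, -Q₀ ≤ q x) ∧ ∀ S, ∃ L, 0 ≤ L ∧ ∀ x, L ≤ |x| → S < q x := by
  have hlarge : ∀ S, ∃ L, 0 ≤ L ∧ ∀ x, L ≤ |x| → S < q x := by
    intro S
    obtain ⟨x₁, h₁⟩ := eventually_atTop.1 (ht.eventually_gt_atTop S)
    obtain ⟨x₂, h₂⟩ := eventually_atBot.1 (hb.eventually_gt_atTop S)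
    refine ⟨max 0 (max x₁ (-x₂)), le_max_left _ _, fun x hx ↦ ?_⟩
    rw [max_le_iff, max_le_iff] at hx
    rcases abs_choice x with h | h <;> rw [h] at hx
    · exact h₁ x hx.2.1
    · exact h₂ x (by linarith [hx.2.2])
  refine ⟨?_, hlarge⟩
  obtain ⟨L, hL, h⟩ := hlarge 0
  obtain ⟨W, hW⟩ := (isCompact_Icc (a := -L) (b := L)).exists_bound_of_continuousOn hq.continuousOn
  refine ⟨max 0 W, le_max_left _ _, fun x ↦ ?_⟩
  rcases le_total L |x| with hx | hx
  · linarith [h x hx, le_max_left 0 W]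
  · have := hW x (abs_le.1 hx)
    rw [Real.norm_eq_abs, abs_le] at this
    linarith [le_max_right 0 W]

/-- A priori bounds for the periodic solutions, uniform in the truncation level. -/
theorem exists_apriori_bound (D : WEData T a e C) (hψc : Continuous ψ) (hψ : StrictMono ψ)
    (hψ0 : ψ 0 = 0) (hF : Continuous F) (hq : Continuous q) (hqt : Tendsto q atTop atTop)
    (hqb : Tendsto q atBot atTop) (S : ℝ) :
    ∃ L, 0 < L ∧ ∀ B > 0, ∀ s, |s| ≤ S → ∀ u v,
      IsSys T (trunc ψ B) (fun _ x ↦ F x) (fun _ x ↦ q x) (fun _ _ ↦ 0) a e s u v →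
      ∀ t ∈ Icc 0 T, |u t| ≤ L ∧ |v t| ≤ L ∧ |v t - F (u t)| ≤ L := by
  have hT := D.pos.le
  obtain ⟨⟨Q₀, hQ₀, hqQ⟩, hlarge⟩ := exists_bounds_of_tendsto hq hqt hqb
  obtain ⟨L₀, hL₀, hL⟩ := hlarge S
  set K : ℝ := |(2 * S + C + 2 * Q₀) * T| with hK
  have hK0 : 0 ≤ K := abs_nonneg _
  set C₁ : ℝ := (K + 1) * (|ψ (K + 1)| + |ψ (-(K + 1))|) with hC₁
  have hC₁0 : 0 ≤ C₁ := by positivity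
  set L₁ : ℝ := L₀ + C₁ * T with hL₁
  have hL₁0 : 0 ≤ L₁ := by positivity
  obtain ⟨W, hW⟩ := (isCompact_Icc (a := -L₁) (b := L₁)).exists_bound_of_continuousOn
    hF.continuousOn
  have hW0 : 0 ≤ W := (norm_nonneg _).trans (hW 0 ⟨by linarith, hL₁0⟩)
  refine ⟨L₁ + 2 * W + 2 * K + 1, by positivity, fun B hB s hs u v h ↦ ?_⟩
  have h0 : (0:ℝ) ∈ Icc 0 T := ⟨le_rfl, hT⟩
  obtain ⟨hi, haq⟩ := D.integral_mul_eq hq h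
  have hib : IntervalIntegrable (fun t ↦ s + e t - a t * q (u t)) volume 0 T :=
    (intervalIntegrable_const.add (D.intervalIntegrable_e 0 T)).sub hi
  have hvK : ∀ t ∈ Icc 0 T, |v t - v 0| ≤ K := by
    intro t ht
    have h1 := h.eq_v t ht
    simp only [add_zero] at h1
    rw [h1, add_sub_cancel_left]
    refine (abs_integral_le_integral_abs_of_mem hib h0 ht).trans ?_
    have h2 : ∫ t in (0:ℝ)..T, |s + e t - a t * q (u t)| ≤
        ∫ t in (0:ℝ)..T, (S + C + (a t * q (u t) + a t * (2 * Q₀))) := by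
      refine intervalIntegral.integral_mono_on hT hib.abs (intervalIntegrable_const.add
        (hi.add ((D.intervalIntegrable_a 0 T).mul_const _))) fun t _ ↦ ?_
      have h3 : |a t * q (u t)| ≤ a t * q (u t) + a t * (2 * Q₀) := by
        rw [abs_mul, abs_of_nonneg (D.a_nonneg t), ← mul_add]
        refine mul_le_mul_of_nonneg_left ?_ (D.a_nonneg t)
        rw [abs_le]
        constructor <;> linarith [hqQ (u t)]
      have h4 := D.e_le t
      rw [abs_le] at *
      constructor <;> linarith
    rw [intervalIntegral.integral_add intervalIntegrable_const
      (hi.add ((D.intervalIntegrable_a 0 T).mul_const _)),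
      intervalIntegral.integral_add hi ((D.intervalIntegrable_a 0 T).mul_const _),
      intervalIntegral.integral_mul_const, haq, D.int_a, intervalIntegral.integral_const] at h2
    refine h2.trans (le_trans ?_ (le_abs_self _))
    have h5 := mul_le_mul_of_nonneg_right ((le_abs_self s).trans hs) hT
    simp only [sub_zero, smul_eq_mul]
    linarith
  set g : ℝ → ℝ := fun t ↦ trunc ψ B (v t - F (u t)) with hg
  have hgc : Continuous g :=
    (continuous_trunc hψc B).comp (h.cont_v.sub (hF.comp h.cont_u))
  have hu := h.eq_u
  have hFu := integral_comp_mul_eq_zero hT h.cont_u hgc hF hu h.per_u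
  have h1u := integral_comp_mul_eq_zero hT h.cont_u hgc (continuous_const (y := v 0)) hu h.per_u
  have hen : (K + 1) * ∫ t in (0:ℝ)..T, |g t| ≤ K * (∫ t in (0:ℝ)..T, |g t|) + C₁ * T := by
    have hv := h.cont_v
    have hu' := h.cont_u
    have e1 : ∫ t in (0:ℝ)..T, (v t - F (u t)) * g t = ∫ t in (0:ℝ)..T, (v t - v 0) * g t := by
      have : ∀ t, (v t - F (u t)) * g t = (v t - v 0) * g t + (v 0 * g t - F (u t) * g t) :=
        fun t ↦ by ring
      simp only [this]
      rw [intervalIntegral.integral_add (Continuous.intervalIntegrable (by fun_prop) _ _)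
        (Continuous.intervalIntegrable (by fun_prop) _ _),
        intervalIntegral.integral_sub (Continuous.intervalIntegrable (by fun_prop) _ _)
        (Continuous.intervalIntegrable (by fun_prop) _ _), hFu, h1u]
      ring
    have e2 : ∫ t in (0:ℝ)..T, (v t - v 0) * g t ≤ ∫ t in (0:ℝ)..T, K * |g t| := by
      refine intervalIntegral.integral_mono_on hT (Continuous.intervalIntegrable (by fun_prop) _ _)
        (Continuous.intervalIntegrable (by fun_prop) _ _) fun t ht ↦ ?_
      refine (le_abs_self _).trans ?_
      rw [abs_mul]
      exact mul_le_mul_of_nonneg_right (hvK t ht) (abs_nonneg _)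
    have e3 : ∫ t in (0:ℝ)..T, (K + 1) * |g t| ≤
        ∫ t in (0:ℝ)..T, ((v t - F (u t)) * g t + C₁) := by
      refine intervalIntegral.integral_mono_on hT (Continuous.intervalIntegrable (by fun_prop) _ _)
        (Continuous.intervalIntegrable (by fun_prop) _ _) fun t ht ↦ ?_
      exact mul_abs_trunc_le hψ hψ0 hB (by linarith) _
    rw [intervalIntegral.integral_add (Continuous.intervalIntegrable (by fun_prop) _ _)
      intervalIntegrable_const, intervalIntegral.integral_const_mul, e1] at e3
    rw [intervalIntegral.integral_const_mul] at e2
    simp only [intervalIntegral.integral_const, sub_zero, smul_eq_mul] at e3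
    linarith
  have hg1 : ∫ t in (0:ℝ)..T, |g t| ≤ C₁ * T := by linarith
  obtain ⟨t₁, ht₁, hut₁⟩ : ∃ t ∈ Icc 0 T, |u t| ≤ L₀ := by
    by_contra! hcon
    obtain ⟨t₂, ht₂, hmin⟩ := (isCompact_Icc (a := (0:ℝ)) (b := T)).exists_isMinOn ⟨0, h0⟩
      (hq.comp h.cont_u).continuousOn
    have h1 := D.exists_le_of_isSys hq h (k := q (u t₂)) fun t ht ↦ hmin ht
    have h2 := hL _ (hcon t₂ ht₂).le
    linarith [le_abs_self s]
  have huL : ∀ t ∈ Icc 0 T, |u t| ≤ L₁ := by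
    intro t ht
    have h1 : u t - u t₁ = ∫ τ in t₁..t, g τ := by
      rw [hu t ht, hu t₁ ht₁, add_sub_add_left_eq_sub]
      exact intervalIntegral.integral_interval_sub_left (hgc.intervalIntegrable _ _)
        (hgc.intervalIntegrable _ _)
    have h2 := abs_integral_le_integral_abs_of_mem (hgc.intervalIntegrable 0 T) ht₁ ht
    rw [← h1] at h2
    have h3 := abs_sub_abs_le_abs_sub (u t) (u t₁)
    linarith
  have hFW : ∀ t ∈ Icc 0 T, |F (u t)| ≤ W := fun t ht ↦ hW _ (abs_le.1 (huL t ht))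
  obtain ⟨c, hc, hgc0⟩ := exists_hasDerivAt_eq_zero D.pos h.cont_u.continuousOn h.per_u.symm
    fun t ht ↦ hasDerivAt_of_eq_integral hgc hu ht
  have hc' := Ioo_subset_Icc_self hc
  have hyc : v c - F (u c) = 0 := by
    rcases lt_trichotomy (v c - F (u c)) 0 with h1 | h1 | h1
    · exact absurd hgc0 (trunc_neg hψ hψ0 hB h1).ne
    · exact h1
    · exact absurd hgc0 (trunc_pos hψ hψ0 hB h1).ne'
  intro t ht
  have h1 := hvK t ht
  have h2 := hvK c hc'
  have h3 := hFW t ht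
  have h4 := hFW c hc'
  have h5 := huL t ht
  rw [abs_le] at *
  refine ⟨⟨?_, ?_⟩, abs_le.2 ⟨?_, ?_⟩, abs_le.2 ⟨?_, ?_⟩⟩ <;> linarith

end

/-- A `T`-periodic strict upper solution of the system
`u' = ψ (v - F u)`, `v' = s + e(t) - a(t) q(u)`. -/
structure IsStrictUpper (T : ℝ) (ψ F q a e : ℝ → ℝ) (s : ℝ) (β w : ℝ → ℝ) : Prop where
  cont_β : Continuous β
  cont_w : Continuous w
  per_β : β T = β 0
  per_w : w T = w 0
  eq_β : ∀ t ∈ Icc 0 T, β t = β 0 + ∫ τ in (0:ℝ)..t, ψ (w τ - F (β τ))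
  sub_le : ∃ δ > 0, ∀ x ∈ Icc 0 T, ∀ y ∈ Icc 0 T, x ≤ y →
    w y - w x ≤ (∫ τ in x..y, (s + e τ - a τ * q (β τ))) - δ * (y - x)

theorem nonpos_of_max_left {d : ℝ → ℝ} {h t₀ T : ℝ} (ht₀ : t₀ < T) (hd : HasDerivAt d h t₀)
    (hmax : ∀ t ∈ Ioo t₀ T, d t ≤ d t₀) : h ≤ 0 := by
  refine le_of_tendsto hd.tendsto_slope_zero_right ?_
  filter_upwards [Ioo_mem_nhdsGT (sub_pos.2 ht₀)] with x hx
  exact mul_nonpos_of_nonneg_of_nonpos (inv_nonneg.2 hx.1.le)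
    (sub_nonpos.2 (hmax _ ⟨by linarith [hx.1], by linarith [hx.2]⟩))

theorem nonneg_of_max_right {d : ℝ → ℝ} {h t₀ T : ℝ} (ht₀ : T < t₀) (hd : HasDerivAt d h t₀)
    (hmax : ∀ t ∈ Ioo T t₀, d t ≤ d t₀) : 0 ≤ h := by
  refine ge_of_tendsto hd.tendsto_slope_zero_left ?_
  filter_upwards [Ioo_mem_nhdsLT (sub_neg.2 ht₀)] with x hx
  exact mul_nonneg_of_nonpos_of_nonpos (inv_nonpos.2 hx.2.le)
    (sub_nonpos.2 (hmax _ ⟨by linarith [hx.1], by linarith [hx.2]⟩))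

theorem abs_integral_sub_le {f : ℝ → ℝ} (hf : Continuous f) {L Λ : ℝ}
    (hΛ : ∀ x ∈ Icc (-L) L, |f x| ≤ Λ) {x y : ℝ} (hx : |x| ≤ L) (hy : |y| ≤ L) :
    |(∫ τ in (0:ℝ)..x, f τ) - ∫ τ in (0:ℝ)..y, f τ| ≤ Λ * |x - y| := by
  rw [intervalIntegral.integral_interval_sub_left (hf.intervalIntegrable _ _)
    (hf.intervalIntegrable _ _)]
  refine intervalIntegral.norm_integral_le_of_norm_le_const (f := f) fun t ht ↦ hΛ t ?_
  exact uIcc_subset_Icc (abs_le.1 hy) (abs_le.1 hx) (uIoc_subset_uIcc ht)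

section

variable {T C : ℝ} {a e ψ f q : ℝ → ℝ}

/-- Periodic solutions of the system modified above a strict upper solution stay below it. -/
theorem IsStrictUpper.lt {s B : ℝ} {F β w u v : ℝ → ℝ} (D : WEData T a e C) (hψc : Continuous ψ)
    (hψ : StrictMono ψ) (hf : Continuous f) (hF : ∀ x, F x = ∫ τ in (0:ℝ)..x, f τ)
    (hq : Continuous q) (hβ : IsStrictUpper T ψ F q a e s β w)
    (hB : ∀ t ∈ Icc 0 T, |w t - F (β t)| < B)
    (h : IsSys T (trunc ψ B) (fun t x ↦ F (min x (β t))) (fun t x ↦ q (min x (β t)))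
      (fun t x ↦ x - min x (β t)) a e s u v) :
    ∀ t ∈ Icc 0 T, u t < β t := by
  by_contra! hcon
  have hT := D.pos.le
  have h0 : (0:ℝ) ∈ Icc 0 T := ⟨le_rfl, hT⟩
  have hFc : Continuous F := by
    rw [funext hF]
    exact intervalIntegral.continuous_primitive (fun _ _ ↦ hf.intervalIntegrable _ _) 0
  have hθ := continuous_trunc hψc B
  have hu := h.cont_u
  have hv := h.cont_v
  have hβc := hβ.cont_β
  have hwc := hβ.cont_w
  set γ : ℝ → ℝ := fun t ↦ min (u t) (β t) with hγ
  have hγc : Continuous γ := hu.min hβc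
  set y : ℝ → ℝ := fun t ↦ v t - F (γ t) with hy
  set z : ℝ → ℝ := fun t ↦ w t - F (β t) with hz
  have hyc : Continuous y := by fun_prop
  have hzc : Continuous z := by fun_prop
  set g : ℝ → ℝ := fun t ↦ trunc ψ B (y t) - trunc ψ B (z t) with hg
  have hgc : Continuous g := by fun_prop
  have hg0 : g T = g 0 := by simp only [hg, hy, hz, hγ, h.per_u, h.per_v, hβ.per_β, hβ.per_w]
  set d : ℝ → ℝ := fun t ↦ u 0 - β 0 + ∫ τ in (0:ℝ)..t, g τ with hd
  have hdd : ∀ t, HasDerivAt d (g t) t := fun t ↦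
    (intervalIntegral.integral_hasDerivAt_right (hgc.intervalIntegrable _ _)
      (hgc.stronglyMeasurableAtFilter _ _) hgc.continuousAt).const_add _
  have hdc : Continuous d := continuous_iff_continuousAt.2 fun x ↦ (hdd x).continuousAt
  have hdeq : ∀ t ∈ Icc 0 T, u t - β t = d t := by
    intro t ht
    have h1 : ∫ τ in (0:ℝ)..t, ψ (w τ - F (β τ)) = ∫ τ in (0:ℝ)..t, trunc ψ B (z τ) :=
      intervalIntegral.integral_congr fun τ hτ ↦
        (trunc_of_abs_le ψ (hB τ (uIcc_subset_Icc h0 ht hτ)).le).symm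
    have h2 : ∫ τ in (0:ℝ)..t, g τ =
        (∫ τ in (0:ℝ)..t, trunc ψ B (y τ)) - ∫ τ in (0:ℝ)..t, trunc ψ B (z τ) :=
      intervalIntegral.integral_sub ((hθ.comp hyc).intervalIntegrable _ _)
        ((hθ.comp hzc).intervalIntegrable _ _)
    rw [h.eq_u t ht, hβ.eq_β t ht, h1]
    simp only [hd, h2]
    ring
  have hdper : d T = d 0 := by
    rw [← hdeq T ⟨hT, le_rfl⟩, ← hdeq 0 h0, h.per_u, hβ.per_β]
  obtain ⟨t₀, ht₀, hmax, hnn⟩ : ∃ t₀ ∈ Ico 0 T, (∀ t ∈ Icc 0 T, d t ≤ d t₀) ∧ 0 ≤ d t₀ := by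
    obtain ⟨t₁, ht₁, hm⟩ := (isCompact_Icc (a := (0:ℝ)) (b := T)).exists_isMaxOn ⟨0, h0⟩
      hdc.continuousOn
    have hm' : ∀ t ∈ Icc 0 T, d t ≤ d t₁ := fun t ht ↦ hm ht
    have hnn : 0 ≤ d t₁ := by
      obtain ⟨t, ht, hle⟩ := hcon
      have := hm' t ht
      rw [← hdeq t ht] at this
      linarith
    rcases ht₁.2.lt_or_eq with h1 | h1
    · exact ⟨t₁, ⟨ht₁.1, h1⟩, hm', hnn⟩
    · rw [h1, hdper] at hm' hnn
      exact ⟨0, ⟨le_rfl, D.pos⟩, hm', hnn⟩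
  have ht₀' := Ico_subset_Icc_self ht₀
  have hgt₀ : g t₀ = 0 := by
    refine le_antisymm (nonpos_of_max_left ht₀.2 (hdd t₀) fun t ht ↦
      hmax t ⟨ht₀.1.trans ht.1.le, ht.2.le⟩) ?_
    rcases ht₀.1.eq_or_lt with h1 | h1
    · rw [← h1] at hmax ⊢
      rw [← hg0]
      exact nonneg_of_max_right D.pos (hdd T) fun t ht ↦
        hdper ▸ hmax t (Ioo_subset_Icc_self ht)
    · exact nonneg_of_max_right h1 (hdd t₀) fun t ht ↦
        hmax t ⟨ht.1.le, ht.2.le.trans ht₀.2.le⟩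
  have hyz : y t₀ = z t₀ := by
    rcases lt_trichotomy (y t₀) (z t₀) with h1 | h1 | h1
    · have := trunc_lt_trunc hψ h1 (Or.inr (hB t₀ ht₀'))
      simp only [hg] at hgt₀
      linarith
    · exact h1
    · have := trunc_lt_trunc hψ h1 (Or.inl (hB t₀ ht₀'))
      simp only [hg] at hgt₀
      linarith
  have hγβ : γ t₀ = β t₀ := min_eq_right (by linarith [hdeq t₀ ht₀'])
  obtain ⟨δ, hδ, hsub⟩ := hβ.sub_le
  obtain ⟨L₁, hL₁⟩ := (isCompact_Icc (a := (0:ℝ)) (b := T)).exists_bound_of_continuousOn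
    hγc.continuousOn
  obtain ⟨L₂, hL₂⟩ := (isCompact_Icc (a := (0:ℝ)) (b := T)).exists_bound_of_continuousOn
    hβc.continuousOn
  set L : ℝ := max L₁ L₂ with hL
  obtain ⟨Λ, hΛ⟩ := (isCompact_Icc (a := -L) (b := L)).exists_bound_of_continuousOn
    hf.continuousOn
  set Λ' : ℝ := |Λ| + 1 with hΛ'
  have hΛpos : 0 < Λ' := by positivity
  have hFL : ∀ t ∈ Icc 0 T, F (γ t) - F (β t) ≤ Λ' * (d t₀ - d t) := by
    intro t ht
    have h1 := abs_integral_sub_le hf hΛ ((hL₁ t ht).trans (le_max_left L₁ L₂))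
      ((hL₂ t ht).trans (le_max_right L₁ L₂))
    rw [← hF, ← hF] at h1
    refine (le_abs_self _).trans (h1.trans ?_)
    have h2 : |γ t - β t| ≤ d t₀ - d t := by
      have h3 := hmax t ht
      have h4 := hdeq t ht
      simp only [hγ]
      rcases le_total (u t) (β t) with h5 | h5
      · rw [min_eq_left h5, abs_of_nonpos (by linarith)]
        linarith
      · rw [min_eq_right h5, sub_self, abs_zero]
        linarith
    exact mul_le_mul (by linarith [le_abs_self Λ]) h2 (abs_nonneg _) hΛpos.le
  have hsmall : ∀ᶠ t in nhds t₀, Λ' * |d t - d t₀| ≤ δ / 4 * |t - t₀| := by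
    have h1 := (hdd t₀).isLittleO.def (c := δ / 4 / Λ') (by positivity)
    rw [hgt₀] at h1
    filter_upwards [h1] with t ht
    simp only [smul_zero, sub_zero, Real.norm_eq_abs] at ht
    calc Λ' * |d t - d t₀| ≤ Λ' * (δ / 4 / Λ' * |t - t₀|) := by gcongr
      _ = δ / 4 * |t - t₀| := by field_simp
  have hqsmall : ∀ᶠ t in nhds t₀, C * |q (γ t) - q (β t)| < δ / 2 := by
    have h1 : Continuous fun t ↦ C * |q (γ t) - q (β t)| := by fun_prop
    refine h1.tendsto t₀ |>.eventually_lt_const ?_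
    simp only [hγβ, sub_self, abs_zero, mul_zero]
    positivity
  obtain ⟨ρ, hρ, hball⟩ := Metric.eventually_nhds_iff.1 (hsmall.and hqsmall)
  set t₁ : ℝ := min T (t₀ + ρ / 2) with ht₁
  have ht₁0 : t₀ < t₁ := lt_min ht₀.2 (by linarith)
  have hmem : ∀ t ∈ Icc t₀ t₁, t ∈ Icc 0 T ∧ dist t t₀ < ρ := by
    intro t ht
    refine ⟨⟨ht₀.1.trans ht.1, ht.2.trans (min_le_left _ _)⟩, ?_⟩
    have : t ≤ t₀ + ρ / 2 := ht.2.trans (min_le_right _ _)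
    rw [Real.dist_eq, abs_of_nonneg (by linarith [ht.1])]
    linarith
  have hpos : ∀ t ∈ Ioo t₀ t₁, 0 < g t := by
    intro t ht
    obtain ⟨htT, htρ⟩ := hmem t (Ioo_subset_Icc_self ht)
    have hlt : z t < y t := by
      have iQ : ∀ x y : ℝ, ∀ k : ℝ → ℝ, Continuous k →
          IntervalIntegrable (fun τ ↦ s + e τ - a τ * q (k τ)) volume x y := fun x y k hk ↦
        (intervalIntegrable_const.add (D.intervalIntegrable_e x y)).sub
          ((D.intervalIntegrable_a x y).mul_continuousOn (hq.comp hk).continuousOn)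
      have iγ : ∀ x y : ℝ, IntervalIntegrable
          (fun τ ↦ s + e τ - a τ * q (γ τ) + (u τ - γ τ)) volume x y := fun x y ↦
        (iQ x y γ hγc).add ((hu.sub hγc).intervalIntegrable _ _)
      have h1 : v t - v t₀ = ∫ τ in t₀..t, (s + e τ - a τ * q (γ τ) + (u τ - γ τ)) := by
        rw [h.eq_v t htT, h.eq_v t₀ ht₀', add_sub_add_left_eq_sub]
        exact intervalIntegral.integral_interval_sub_left (iγ _ _) (iγ _ _)
      have h2 := hsub t₀ ht₀' t htT ht.1.le
      have h3 : ∫ τ in t₀..t, (s + e τ - a τ * q (β τ) - δ / 2) ≤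
          ∫ τ in t₀..t, (s + e τ - a τ * q (γ τ) + (u τ - γ τ)) := by
        refine intervalIntegral.integral_mono_on ht.1.le
          ((iQ _ _ β hβc).sub intervalIntegrable_const) (iγ _ _) fun τ hτ ↦ ?_
        obtain ⟨-, hτρ⟩ := hmem τ ⟨hτ.1, hτ.2.trans ht.2.le⟩
        have h4 := (hball hτρ).2
        have h5 : a τ * (q (γ τ) - q (β τ)) ≤ C * |q (γ τ) - q (β τ)| :=
          (mul_le_mul_of_nonneg_left (le_abs_self _) (D.a_nonneg τ)).trans
            (mul_le_mul_of_nonneg_right (D.a_le τ) (abs_nonneg _))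
        have h6 : γ τ ≤ u τ := min_le_left _ _
        linarith
      rw [intervalIntegral.integral_sub (iQ _ _ β hβc) intervalIntegrable_const,
        intervalIntegral.integral_const, smul_eq_mul] at h3
      have h7 := hFL t htT
      have h8 := (hball htρ).1
      rw [abs_of_nonneg (sub_nonneg.2 ht.1.le)] at h8
      have h9 : Λ' * (d t₀ - d t) ≤ Λ' * |d t - d t₀| := by
        rw [abs_sub_comm]
        exact mul_le_mul_of_nonneg_left (le_abs_self _) hΛpos.le
      have h10 : v t₀ = w t₀ := by
        simp only [hy, hz, hγβ] at hyz
        linarith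
      have h11 : 0 < δ * (t - t₀) := mul_pos hδ (sub_pos.2 ht.1)
      simp only [hy, hz]
      linarith
    exact sub_pos.2 (trunc_lt_trunc hψ hlt (Or.inl (hB t htT)))
  have hint := intervalIntegral.intervalIntegral_pos_of_pos_on
    (hgc.intervalIntegrable t₀ t₁) hpos ht₁0
  rw [intervalIntegral.integral_eq_sub_of_hasDerivAt (fun t _ ↦ hdd t)
    (hgc.intervalIntegrable t₀ t₁)] at hint
  have := hmax t₁ (hmem t₁ ⟨ht₁0.le, le_rfl⟩).1
  linarith

end

section

variable {T C : ℝ} {a e ψ f F q : ℝ → ℝ}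

theorem euler_congr {P Q r P' Q' r' : ℝ → ℝ → ℝ} {s : ℝ} {N : ℕ} {x : ℝ × ℝ}
    (h : ∀ i < N, ∀ z, z = (euler T ψ P Q r a e s N x i).1 → P (node T N i) z = P' (node T N i) z ∧
      Q (node T N i) z = Q' (node T N i) z ∧ r (node T N i) z = r' (node T N i) z) :
    ∀ i ≤ N, euler T ψ P Q r a e s N x i = euler T ψ P' Q' r' a e s N x i := by
  intro i
  induction i with
  | zero => exact fun _ ↦ rfl
  | succ i ih =>
    intro hi
    obtain ⟨h1, h2, h3⟩ := h i hi _ rfl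
    simp only [euler]
    rw [h1, h2, h3, ih (Nat.le_of_succ_le hi)]

/-- Above a strict upper solution there are two different periodic solutions. -/
theorem IsStrictUpper.exists_two (D : WEData T a e C) (hψc : Continuous ψ)
    (hψ : StrictMono ψ) (hψ0 : ψ 0 = 0) (hf : Continuous f)
    (hF : ∀ x, F x = ∫ τ in (0:ℝ)..x, f τ) (hq : Continuous q) (hqt : Tendsto q atTop atTop)
    (hqb : Tendsto q atBot atTop) {s : ℝ} {β w : ℝ → ℝ}
    (hβ : IsStrictUpper T ψ F q a e s β w) :
    ∃ u₁ v₁ u₂ v₂ : ℝ → ℝ,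
      IsSys T ψ (fun _ x ↦ F x) (fun _ x ↦ q x) (fun _ _ ↦ 0) a e s u₁ v₁ ∧
      IsSys T ψ (fun _ x ↦ F x) (fun _ x ↦ q x) (fun _ _ ↦ 0) a e s u₂ v₂ ∧
      ∃ t ∈ Icc 0 T, u₁ t ≠ u₂ t := by
  have hT := D.pos.le
  have hFc : Continuous F := by
    rw [funext hF]
    exact intervalIntegral.continuous_primitive (fun _ _ ↦ hf.intervalIntegrable _ _) 0
  have hβc := hβ.cont_β
  have hwc := hβ.cont_w
  obtain ⟨L, hL, hbound⟩ := exists_apriori_bound D hψc hψ hψ0 hFc hq hqt hqb |s|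
  obtain ⟨Wy, hWy⟩ := (isCompact_Icc (a := (0:ℝ)) (b := T)).exists_bound_of_continuousOn
    (f := fun t ↦ w t - F (β t)) (by fun_prop)
  set B : ℝ := L + |Wy| + 1 with hB
  have hBpos : 0 < B := by positivity
  have hwB : ∀ t ∈ Icc 0 T, |w t - F (β t)| < B := fun t ht ↦ by
    have := hWy t ht
    rw [Real.norm_eq_abs] at this
    linarith [le_abs_self Wy]
  set θ : ℝ → ℝ := trunc ψ B with hθ
  have hθc : Continuous θ := continuous_trunc hψc B
  set Ψ : ℝ := |ψ B| + |ψ (-B)| with hΨ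
  have hθΨ : ∀ y, |θ y| ≤ Ψ := abs_trunc_le hψ hBpos.le
  have hΨ0 : 0 ≤ Ψ := by positivity
  have hθp : ∀ y, 0 < y → 0 < θ y := fun y ↦ trunc_pos hψ hψ0 hBpos
  have hθn : ∀ y, y < 0 → θ y < 0 := fun y ↦ trunc_neg hψ hψ0 hBpos
  set P₀ : ℝ → ℝ → ℝ := fun _ x ↦ F x with hP₀
  set Q₀ : ℝ → ℝ → ℝ := fun _ x ↦ q x with hQ₀
  set r₀ : ℝ → ℝ → ℝ := fun _ _ ↦ 0 with hr₀
  set P₁ : ℝ → ℝ → ℝ := fun t x ↦ F (min x (β t)) with hP₁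
  set Q₁ : ℝ → ℝ → ℝ := fun t x ↦ q (min x (β t)) with hQ₁
  set r₁ : ℝ → ℝ → ℝ := fun t x ↦ x - min x (β t) with hr₁
  have cP₀ : Continuous fun x : ℝ × ℝ ↦ P₀ x.1 x.2 := by fun_prop
  have cQ₀ : Continuous fun x : ℝ × ℝ ↦ Q₀ x.1 x.2 := by fun_prop
  have cr₀ : Continuous fun x : ℝ × ℝ ↦ r₀ x.1 x.2 := by fun_prop
  have cP₁ : Continuous fun x : ℝ × ℝ ↦ P₁ x.1 x.2 := by fun_prop
  have cQ₁ : Continuous fun x : ℝ × ℝ ↦ Q₁ x.1 x.2 := by fun_prop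
  have cr₁ : Continuous fun x : ℝ × ℝ ↦ r₁ x.1 x.2 := by fun_prop
  have hagree : ∀ t x, x ≤ β t → P₀ t x = P₁ t x ∧ Q₀ t x = Q₁ t x ∧ r₀ t x = r₁ t x := by
    intro t x hx
    simp only [hP₀, hP₁, hQ₀, hQ₁, hr₀, hr₁, min_eq_left hx, sub_self, and_self]
  have exact_of_trunc : ∀ u v, IsSys T θ P₀ Q₀ r₀ a e s u v → IsSys T ψ P₀ Q₀ r₀ a e s u v :=
    fun u v h ↦ h.congr (fun t ht ↦ trunc_of_abs_le ψ
      ((hbound B hBpos s le_rfl u v h t ht).2.2.trans (by linarith [abs_nonneg Wy])))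
      fun _ _ ↦ rfl
  have below : ∀ u v, IsSys T θ P₁ Q₁ r₁ a e s u v → ∀ t ∈ Icc 0 T, u t < β t :=
    fun u v h ↦ hβ.lt D hψc hψ hf hF hq hwB h
  obtain ⟨Lβ, hLβ⟩ := (isCompact_Icc (a := (0:ℝ)) (b := T)).exists_bound_of_continuousOn
    hβc.continuousOn
  obtain ⟨Wq, hWq⟩ := (isCompact_Icc (a := (0:ℝ)) (b := T)).exists_bound_of_continuousOn
    (hq.comp hβc).continuousOn
  obtain ⟨-, hlarge⟩ := exists_bounds_of_tendsto hq hqt hqb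
  obtain ⟨Lq, hLq0, hLq⟩ := hlarge (|s| + 1)
  set R : ℝ := Ψ * T + Lq + |Lβ| + |s| + |Wq| + 1 with hR
  have hRpos : 0 < R := by positivity
  obtain ⟨W₀, hW₀⟩ := exists_boundedOn cP₀ cQ₀ cr₀ T (R + Ψ * T)
  obtain ⟨W₁, hW₁⟩ := exists_boundedOn cP₁ cQ₁ cr₁ T (R + Ψ * T)
  set R' : ℝ := |(|s| + C + C * W₀ + W₀) * T + W₀| + |(|s| + C + C * W₁ + W₁) * T + W₁| + 1
    with hR'
  have hR'pos : 0 < R' := by positivity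
  have hR'₀ : (|s| + C + C * W₀ + W₀) * T + W₀ < R' := by
    linarith [le_abs_self ((|s| + C + C * W₀ + W₀) * T + W₀),
      abs_nonneg ((|s| + C + C * W₁ + W₁) * T + W₁)]
  have hR'₁ : (|s| + C + C * W₁ + W₁) * T + W₁ < R' := by
    linarith [le_abs_self ((|s| + C + C * W₁ + W₁) * T + W₁),
      abs_nonneg ((|s| + C + C * W₀ + W₀) * T + W₀)]
  set E₀ : ℕ → ℝ × ℝ → ℕ → ℝ × ℝ := fun N x i ↦ euler T θ P₀ Q₀ r₀ a e s N x i with hE₀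
  set E₁ : ℕ → ℝ × ℝ → ℕ → ℝ × ℝ := fun N x i ↦ euler T θ P₁ Q₁ r₁ a e s N x i with hE₁
  have cE₀ : ∀ N i, Continuous fun x ↦ E₀ N x i := continuous_euler D hθc cP₀ cQ₀ cr₀ s
  have cE₁ : ∀ N i, Continuous fun x ↦ E₁ N x i := continuous_euler D hθc cP₁ cQ₁ cr₁ s
  have hsT : (s - (|s| + 1) + 0) * T < 0 :=
    mul_neg_of_neg_of_pos (by linarith [le_abs_self s]) D.pos
  have sign₀ : ∀ N, 0 < N → ∀ c p : ℝ, |c| = R → |p| ≤ R' → (E₀ N (c, p) N).2 - p < 0 := by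
    intro N hN c p hc _
    refine (euler_snd_le D s hN (c, p) (k := |s| + 1) (m := 0) (fun i hi ↦ ?_)
      fun i hi ↦ le_rfl).trans_lt hsT
    have h1 := abs_euler_fst_sub_le (P := P₀) (Q := Q₀) (r := r₀) D hθΨ s hN (c, p) hi
    refine (hLq _ ?_).le
    have h2 := abs_sub_abs_le_abs_sub c (E₀ N (c, p) i).1
    rw [abs_sub_comm] at h2
    have h3 : R - |(E₀ N (c, p) i).1| ≤ Ψ * T := hc ▸ h2.trans h1
    linarith [abs_nonneg Lβ, abs_nonneg s, abs_nonneg Wq]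
  have sign₁ : ∀ N, 0 < N → ∀ c p : ℝ, |c| = R → |p| ≤ R' → 0 < c * ((E₁ N (c, p) N).2 - p) := by
    intro N hN c p hc _
    have h1 : ∀ i ≤ N, |(E₁ N (c, p) i).1 - c| ≤ Ψ * T := fun i hi ↦
      abs_euler_fst_sub_le (P := P₁) (Q := Q₁) (r := r₁) D hθΨ s hN (c, p) hi
    have h2 : ∀ i ≤ N, |β (node T N i)| ≤ |Lβ| := fun i hi ↦
      (hLβ _ (node_mem hT hN hi)).trans (le_abs_self _)
    rcases abs_choice c with h | h
    · have hcR : c = R := by rw [← h, hc]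
      have h3 : ∀ i ≤ N, β (node T N i) + (|s| + |Wq| + 1) ≤ (E₁ N (c, p) i).1 := by
        intro i hi
        have h4 := abs_le.1 (h1 i hi)
        have h5 := abs_le.1 (h2 i hi)
        linarith
      refine mul_pos (hcR ▸ hRpos) (lt_of_lt_of_le ?_ (le_euler_snd D s hN (c, p) (k := |Wq|)
        (m := |s| + |Wq| + 1) (fun i hi ↦ ?_) fun i hi ↦ ?_))
      · exact mul_pos (by linarith [neg_abs_le s]) D.pos
      · have h4 := h3 i hi
        change q (min (E₁ N (c, p) i).1 (β (node T N i))) ≤ _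
        rw [min_eq_right (by linarith [abs_nonneg s, abs_nonneg Wq])]
        exact (le_abs_self _).trans ((hWq _ (node_mem hT hN hi)).trans (le_abs_self _))
      · have h4 := h3 i hi
        change _ ≤ (E₁ N (c, p) i).1 - min (E₁ N (c, p) i).1 (β (node T N i))
        rw [min_eq_right (by linarith [abs_nonneg s, abs_nonneg Wq])]
        linarith
    · have hcR : c = -R := by rw [← hc, h, neg_neg]
      have h3 : ∀ i ≤ N, (E₁ N (c, p) i).1 ≤ β (node T N i) ∧ (E₁ N (c, p) i).1 ≤ -Lq := by
        intro i hi
        have h4 := abs_le.1 (h1 i hi)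
        have h5 := abs_le.1 (h2 i hi)
        constructor <;> linarith [abs_nonneg s, abs_nonneg Wq, abs_nonneg Lβ]
      refine mul_pos_of_neg_of_neg (by linarith) (lt_of_le_of_lt (euler_snd_le D s hN (c, p)
        (k := |s| + 1) (m := 0) (fun i hi ↦ ?_) fun i hi ↦ ?_) hsT)
      · change _ ≤ q (min (E₁ N (c, p) i).1 (β (node T N i)))
        rw [min_eq_left (h3 i hi).1]
        refine (hLq _ ?_).le
        linarith [neg_le_abs (E₁ N (c, p) i).1, (h3 i hi).2]
      · change (E₁ N (c, p) i).1 - min (E₁ N (c, p) i).1 (β (node T N i)) ≤ 0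
        rw [min_eq_left (h3 i hi).1, sub_self]
  have fst₀ : ∀ N, 0 < N → ∀ c p : ℝ, |c| ≤ R → |p| = R' → 0 < p * ((E₀ N (c, p) N).1 - c) :=
    fun N hN c p hc hp ↦ euler_fst_sign D hθΨ hθc hθp hθn hW₀ le_rfl hR'₀ hN (x := (c, p)) hc hp
  have fst₁ : ∀ N, 0 < N → ∀ c p : ℝ, |c| ≤ R → |p| = R' → 0 < p * ((E₁ N (c, p) N).1 - c) :=
    fun N hN c p hc hp ↦ euler_fst_sign D hθΨ hθc hθp hθn hW₁ le_rfl hR'₁ hN (x := (c, p)) hc hp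
  have zero₁ : ∀ N, 0 < N → ∃ x : ℝ × ℝ, |x.1| ≤ R ∧ |x.2| ≤ R' ∧ E₁ N x N = x := by
    intro N hN
    by_contra! hno
    have hc := cE₁ N N
    refine false_of_boundary_signs hRpos hR'pos (fun x ↦ x.2) (fun _ ↦ -1)
      (fun x ↦ (E₁ N x N).1 - x.1) (fun x ↦ (E₁ N x N).2 - x.2) (by fun_prop) (by fun_prop)
      (by fun_prop) (by fun_prop) ∅ univ isClosed_empty isClosed_univ (by simp) (by simp)
      (by simp) (fun x _ h1 h2 h3 ↦ hno x h1 h2 ?_) (by simp) (fun c p _ hp ↦ ?_)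
      (sign₁ N hN) (fst₁ N hN)
    · exact Prod.ext (sub_eq_zero.1 h3.1) (sub_eq_zero.1 h3.2)
    · have : p ≠ 0 := by
        rintro rfl
        simp at hp
        linarith
      exact mul_self_pos.2 this
  obtain ⟨u₁, v₁, hsys₁, -⟩ : ∃ u v, IsSys T θ P₁ Q₁ r₁ a e s u v ∧ ∃ t ∈ Icc 0 T, -R ≤ u t := by
    choose x hx1 hx2 hx using fun n : ℕ ↦ zero₁ (n + 1) n.succ_pos
    exact exists_solution_of_euler D hθc cP₁ cQ₁ cr₁ hθΨ (b := fun _ ↦ -R) continuous_const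
      (N := fun n ↦ n + 1) (i := fun _ ↦ 0) (x := x) (fun n ↦ n.lt_succ_self)
      (fun n ↦ n.succ_pos) hx1 hx2 hx fun n ↦ (abs_le.1 (hx1 n)).1
  have hlt₁ := below u₁ v₁ hsys₁
  have hsys₁' : IsSys T θ P₀ Q₀ r₀ a e s u₁ v₁ := by
    refine hsys₁.congr (fun t ht ↦ ?_) fun t ht ↦ ?_
    · rw [(hagree t (u₁ t) (hlt₁ t ht).le).1]
    · rw [(hagree t (u₁ t) (hlt₁ t ht).le).2.1, (hagree t (u₁ t) (hlt₁ t ht).le).2.2]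
  obtain ⟨N₀, hN₀⟩ : ∃ N₀, ∀ N > N₀, ∀ x : ℝ × ℝ, |x.1| ≤ R → |x.2| ≤ R' → E₁ N x N = x →
      ∀ i < N, (E₁ N x i).1 < β (node T N i) := by
    by_contra! hcon
    choose N hN x hx1 hx2 hx i hi hbi using hcon
    obtain ⟨u, v, h, t, ht, hle⟩ := exists_solution_of_euler D hθc cP₁ cQ₁ cr₁ hθΨ hβc
      hN hi hx1 hx2 hx hbi
    exact absurd (below u v h t ht) (not_lt.2 hle)
  have zero₀ : ∀ n, ∃ x : ℝ × ℝ, |x.1| ≤ R ∧ |x.2| ≤ R' ∧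
      E₀ (N₀ + 1 + n) x (N₀ + 1 + n) = x ∧
      ∃ i < N₀ + 1 + n, β (node T (N₀ + 1 + n) i) ≤ (E₀ (N₀ + 1 + n) x i).1 := by
    intro n
    set N := N₀ + 1 + n with hNdef
    have hN : 0 < N := by omega
    have hNgt : N > N₀ := by omega
    by_contra! hno
    have hc₀ := cE₀ N N
    have hc₁ := cE₁ N N
    refine false_of_boundary_signs hRpos hR'pos
      (fun x ↦ (E₀ N x N).1 - x.1) (fun x ↦ (E₀ N x N).2 - x.2)
      (fun x ↦ (E₁ N x N).1 - x.1) (fun x ↦ (E₁ N x N).2 - x.2) (by fun_prop) (by fun_prop)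
      (by fun_prop) (by fun_prop) (⋂ i ∈ {i | i < N}, {x | (E₀ N x i).1 ≤ β (node T N i)})
      (⋃ i ∈ {i | i < N}, {x | β (node T N i) ≤ (E₀ N x i).1}) ?_ ?_ ?_ ?_ ?_ ?_
      (sign₀ N hN) (fst₀ N hN) (sign₁ N hN) (fst₁ N hN)
    · exact isClosed_biInter fun i _ ↦
        isClosed_le (continuous_fst.comp (cE₀ N i)) continuous_const
    · exact (finite_lt_nat N).isClosed_biUnion fun i _ ↦
        isClosed_le continuous_const (continuous_fst.comp (cE₀ N i))
    · intro x
      by_contra! hx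
      simp only [mem_iInter, mem_iUnion, mem_ofPred_eq, not_exists, not_le] at hx
      exact hx.1 fun i hi ↦ (hx.2 i hi).le
    · intro x hx
      simp only [mem_iInter, mem_ofPred_eq] at hx
      have h1 : E₀ N x N = E₁ N x N := euler_congr (fun i hi z hz ↦ by
        subst hz
        exact hagree _ _ (hx i hi)) N le_rfl
      simp only [h1, and_self]
    · intro x hx h1 h2 h3
      simp only [mem_iUnion, mem_ofPred_eq] at hx
      obtain ⟨i, hi, hle⟩ := hx
      have := hno x h1 h2 (Prod.ext (sub_eq_zero.1 h3.1) (sub_eq_zero.1 h3.2)) i hi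
      linarith
    · intro x hx h1 h2 h3
      simp only [mem_iUnion, mem_ofPred_eq] at hx
      obtain ⟨i, hi, hle⟩ := hx
      have hlt := hN₀ N hNgt x h1 h2 (Prod.ext (sub_eq_zero.1 h3.1) (sub_eq_zero.1 h3.2))
      have heq : E₁ N x i = E₀ N x i := euler_congr (fun i hi z hz ↦ by
        subst hz
        obtain ⟨k1, k2, k3⟩ := hagree _ _ (hlt i hi).le
        exact ⟨k1.symm, k2.symm, k3.symm⟩) i hi.le
      have := hlt i hi
      rw [heq] at this
      linarith
  obtain ⟨u₂, v₂, hsys₂, t, ht, hle⟩ : ∃ u v, IsSys T θ P₀ Q₀ r₀ a e s u v ∧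
      ∃ t ∈ Icc 0 T, β t ≤ u t := by
    choose x hx1 hx2 hx i hi hbi using zero₀
    exact exists_solution_of_euler D hθc cP₀ cQ₀ cr₀ hθΨ hβc (N := fun n ↦ N₀ + 1 + n) (i := i)
      (x := x) (fun n ↦ by omega) hi hx1 hx2 hx hbi
  exact ⟨u₁, v₁, u₂, v₂, exact_of_trunc _ _ hsys₁', exact_of_trunc _ _ hsys₂, t, ht,
    ((hlt₁ t ht).trans_le hle).ne⟩

theorem IsSys.isStrictUpper (D : WEData T a e C) (hq : Continuous q) {s s₁ : ℝ} (hs : s₁ < s)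
    {u v : ℝ → ℝ} (h : IsSys T ψ (fun _ x ↦ F x) (fun _ x ↦ q x) (fun _ _ ↦ 0) a e s₁ u v) :
    IsStrictUpper T ψ F q a e s u v where
  cont_β := h.cont_u
  cont_w := h.cont_v
  per_β := h.per_u
  per_w := h.per_v
  eq_β := h.eq_u
  sub_le := by
    refine ⟨s - s₁, sub_pos.2 hs, fun x hx y hy _ ↦ ?_⟩
    have hi : ∀ k x y : ℝ, IntervalIntegrable (fun τ ↦ k + e τ - a τ * q (u τ)) volume x y :=
      fun k x y ↦ (intervalIntegrable_const.add (D.intervalIntegrable_e x y)).sub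
        ((D.intervalIntegrable_a x y).mul_continuousOn (hq.comp h.cont_u).continuousOn)
    have h1 := h.eq_v x hx
    have h2 := h.eq_v y hy
    simp only [add_zero] at h1 h2
    rw [h1, h2, add_sub_add_left_eq_sub,
      intervalIntegral.integral_interval_sub_left (hi _ _ _) (hi _ _ _)]
    have h3 : ∫ τ in x..y, (s + e τ - a τ * q (u τ)) =
        ∫ τ in x..y, ((s₁ + e τ - a τ * q (u τ)) + (s - s₁)) := by
      congr 1
      ext τ
      ring
    rw [h3, intervalIntegral.integral_add (hi _ _ _) intervalIntegrable_const,
      intervalIntegral.integral_const, smul_eq_mul]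
    linarith

theorem isStrictUpper_zero (D : WEData T a e C) (hψ0 : ψ 0 = 0) (hF0 : F 0 = 0) :
    IsStrictUpper T ψ F q a e (C + C * |q 0| + 1) (fun _ ↦ 0) (fun _ ↦ 0) where
  cont_β := continuous_const
  cont_w := continuous_const
  per_β := rfl
  per_w := rfl
  eq_β t _ := by simp [hF0, hψ0]
  sub_le := by
    refine ⟨1, one_pos, fun x _ y _ hxy ↦ ?_⟩
    have hi := D.intervalIntegrable_rhs (C + C * |q 0| + 1) (q 0) 0 x y
    simp only [add_zero] at hi
    have h1 : ∫ _ in x..y, (1:ℝ) ≤ ∫ τ in x..y, (C + C * |q 0| + 1 + e τ - a τ * q 0) := by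
      refine intervalIntegral.integral_mono_on hxy intervalIntegrable_const hi fun τ _ ↦ ?_
      have h2 := (abs_le.1 (D.e_le τ)).1
      have h3 : a τ * q 0 ≤ C * |q 0| :=
        (mul_le_mul_of_nonneg_left (le_abs_self _) (D.a_nonneg τ)).trans
          (mul_le_mul_of_nonneg_right (D.a_le τ) (abs_nonneg _))
      linarith
    simp only [intervalIntegral.integral_const, smul_eq_mul, mul_one] at h1
    linarith

/-- The set of parameters for which a periodic solution exists is sequentially closed. -/
theorem exists_isSys_of_tendsto (D : WEData T a e C) (hψc : Continuous ψ)
    (hψ : StrictMono ψ) (hψ0 : ψ 0 = 0) (hF : Continuous F) (hq : Continuous q)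
    (hqt : Tendsto q atTop atTop) (hqb : Tendsto q atBot atTop) {s : ℕ → ℝ} {s₀ : ℝ}
    (hs : Tendsto s atTop (nhds s₀))
    (hsol : ∀ n, ∃ u v : ℝ → ℝ,
      IsSys T ψ (fun _ x ↦ F x) (fun _ x ↦ q x) (fun _ _ ↦ 0) a e (s n) u v) :
    ∃ u v : ℝ → ℝ, IsSys T ψ (fun _ x ↦ F x) (fun _ x ↦ q x) (fun _ _ ↦ 0) a e s₀ u v := by
  have hT := D.pos.le
  obtain ⟨S, hS⟩ := hs.norm.bddAbove_range
  have hsS : ∀ n, |s n| ≤ S := fun n ↦ hS (mem_range_self n)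
  have hs₀ : |s₀| ≤ S := le_of_tendsto' hs.norm hsS
  obtain ⟨L, hL, hbound⟩ := exists_apriori_bound D hψc hψ hψ0 hF hq hqt hqb S
  choose u v h using hsol
  have hb : ∀ n, ∀ t ∈ Icc 0 T, |u n t| ≤ L ∧ |v n t| ≤ L ∧ |v n t - F (u n t)| ≤ L := by
    intro n
    have hu := (h n).cont_u
    have hv := (h n).cont_v
    obtain ⟨B, hB⟩ := (isCompact_Icc (a := (0:ℝ)) (b := T)).exists_bound_of_continuousOn
      (f := fun t ↦ v n t - F (u n t)) (by fun_prop)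
    refine hbound (|B| + 1) (by positivity) (s n) (hsS n) _ _ ((h n).congr (fun t ht ↦ ?_)
      fun _ _ ↦ rfl)
    refine (trunc_of_abs_le ψ ((hB t ht).trans ?_)).symm
    linarith [le_abs_self B]
  have htr : ∀ n, IsSys T (trunc ψ L) (fun _ x ↦ F x) (fun _ x ↦ q x) (fun _ _ ↦ 0) a e (s n)
      (u n) (v n) := fun n ↦
    (h n).congr (fun t ht ↦ (trunc_of_abs_le ψ (hb n t ht).2.2).symm) fun _ _ ↦ rfl
  have h0 : (0:ℝ) ∈ Icc 0 T := ⟨le_rfl, hT⟩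
  obtain ⟨W, hW⟩ := (isCompact_Icc (a := -L) (b := L)).exists_bound_of_continuousOn hq.continuousOn
  have hW0 : 0 ≤ W := (norm_nonneg _).trans (hW 0 ⟨by linarith, hL.le⟩)
  obtain ⟨k, hk, s', u', v', hsys, hs', -⟩ := exists_limit_solution D (continuous_trunc hψc L)
    (P := fun _ x ↦ F x) (Q := fun _ x ↦ q x) (r := fun _ _ ↦ 0) (by fun_prop) (by fun_prop)
    (by fun_prop) (s := s) (ε := fun _ ↦ 0) (S := S) (K := L)
    (M := max (|ψ L| + |ψ (-L)|) (S + C + C * W + W)) hsS tendsto_const_nhds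
    (u := u) (v := v) (U := u) (V := v) (η := fun _ t ↦ t)
    (fun n ↦ (h n).cont_u.measurable) (fun n ↦ (h n).cont_v.measurable)
    (fun _ ↦ measurable_id) (fun n ↦ (hb n 0 h0).1) (fun n ↦ (hb n 0 h0).2.1)
    (fun n t _ ↦ (abs_trunc_le hψ hL.le _).trans (le_max_left _ _))
    (fun n t ht ↦ (D.abs_rhs_le (hsS n) (hW _ (abs_le.1 (hb n t ht).1)) (by simpa using hW0)
      t).trans (le_max_right _ _))
    (fun n ↦ (htr n).eq_u) (fun n ↦ (htr n).eq_v) (by simp) (by simp) (by simp)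
    (fun n ↦ (h n).per_u) (fun n ↦ (h n).per_v)
  obtain rfl : s₀ = s' := tendsto_nhds_unique (hs.comp hk.tendsto_atTop) hs'
  exact ⟨u', v', hsys.congr (fun t ht ↦ trunc_of_abs_le ψ
    (hbound L hL s₀ hs₀ u' v' hsys t ht).2.2) fun _ _ ↦ rfl⟩

end

section

variable {T C : ℝ} {φ ψ f F q a e a' e' : ℝ → ℝ}

theorem IsSolWE.exists_isSys (D : WEData T a' e' C) (ha : ∀ᵐ t ∂muT T, a t = a' t)
    (he : ∀ᵐ t ∂muT T, e t = e' t) (hφc : Continuous φ) (hψφ : ∀ x, ψ (φ x) = x)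
    (hf : Continuous f) (hF : ∀ x, F x = ∫ τ in (0:ℝ)..x, f τ) (hFc : Continuous F) {s : ℝ}
    {u : ℝ → ℝ} (h : IsSolWE T φ f q a e s u) :
    ∃ x v : ℝ → ℝ, IsSys T ψ (fun _ x ↦ F x) (fun _ x ↦ q x) (fun _ _ ↦ 0) a' e' s x v := by
  obtain ⟨u', w, ⟨hd, hu'c, hperu, hperu'⟩, ⟨hwi, hw⟩, heq⟩ := h
  have hT := D.pos.le
  have h0 : (0:ℝ) ∈ Icc 0 T := ⟨le_rfl, hT⟩
  have hTT : T ∈ Icc 0 T := ⟨hT, le_rfl⟩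
  have huc : ContinuousOn u (Icc 0 T) := fun t ht ↦ (hd t ht).continuousWithinAt
  set x : ℝ → ℝ := IccExtend hT ((Icc 0 T).domRestrict u) with hx
  set g : ℝ → ℝ := IccExtend hT ((Icc 0 T).domRestrict u') with hg
  have hxu : ∀ t ∈ Icc 0 T, x t = u t := fun t ht ↦ IccExtend_of_mem hT _ ht
  have hgu : ∀ t ∈ Icc 0 T, g t = u' t := fun t ht ↦ IccExtend_of_mem hT _ ht
  have hxc : Continuous x := huc.domRestrict.Icc_extend'
  have hgc : Continuous g := hu'c.domRestrict.Icc_extend'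
  have hxg : ∀ t ∈ Icc 0 T, x t = x 0 + ∫ τ in (0:ℝ)..t, g τ := by
    intro t ht
    have h1 := intervalIntegral.integral_eq_sub_of_hasDerivAt_of_le (f := x) (f' := g) ht.1
      hxc.continuousOn (fun τ hτ ↦ ?_) (hgc.intervalIntegrable _ _)
    · rw [h1]; ring
    · have hτ' : τ ∈ Ioo 0 T := ⟨hτ.1, hτ.2.trans_le ht.2⟩
      have hmem := Icc_mem_nhds hτ'.1 hτ'.2
      rw [hgu τ (Ioo_subset_Icc_self hτ')]
      refine ((hd τ (Ioo_subset_Icc_self hτ')).hasDerivAt hmem).congr_of_eventuallyEq ?_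
      filter_upwards [hmem] with y hy using hxu y hy
  refine ⟨x, fun t ↦ φ (g t) + F (x t), hxc, by fun_prop, ?_, ?_, ?_, ?_⟩
  · rw [hxu T hTT, hxu 0 h0, hperu]
  · simp only [hxu T hTT, hxu 0 h0, hgu T hTT, hgu 0 h0, hperu, hperu']
  · intro t ht
    simp only [add_sub_cancel_right, hψφ]
    exact hxg t ht
  · intro t ht
    have h1 := integral_comp_mul_eq hxc hgc hf hxg ht
    rw [← hF, ← hF] at h1
    have h2 := hw t ht
    rw [← hgu t ht, ← hgu 0 h0] at h2
    have hsub : uIoc 0 t ⊆ Icc 0 T := uIoc_subset_uIcc.trans (uIcc_subset_Icc h0 ht)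
    have h3 : ∫ τ in (0:ℝ)..t, (s + e' τ - a' τ * q (x τ) + 0) =
        ∫ τ in (0:ℝ)..t, (w τ + f (x τ) * g τ) := by
      refine intervalIntegral.integral_congr_ae ?_
      have hall := ae_imp_of_ae_restrict (ha.and (he.and heq))
      filter_upwards [hall] with τ hτ hτt
      obtain ⟨k1, k2, k3⟩ := hτ (hsub hτt)
      rw [hxu τ (hsub hτt), hgu τ (hsub hτt), ← k1, ← k2]
      linarith
    have hi : IntervalIntegrable (fun τ ↦ f (x τ) * g τ) volume 0 t :=
      ((hf.comp hxc).mul hgc).intervalIntegrable _ _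
    rw [h3, intervalIntegral.integral_add
      (intervalIntegrable_iff.2 (hwi.mono_set hsub)) hi, h1]
    linarith

theorem IsSys.isSolWE (D : WEData T a' e' C) (ha : ∀ᵐ t ∂muT T, a t = a' t)
    (he : ∀ᵐ t ∂muT T, e t = e' t) (hψc : Continuous ψ) (hφψ : ∀ x, φ (ψ x) = x)
    (hf : Continuous f) (hq : Continuous q)
    (hF : ∀ x, F x = ∫ τ in (0:ℝ)..x, f τ) (hFc : Continuous F) {s : ℝ}
    {u v : ℝ → ℝ}
    (h : IsSys T ψ (fun _ x ↦ F x) (fun _ x ↦ q x) (fun _ _ ↦ 0) a' e' s u v) :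
    IsSolWE T φ f q a e s u := by
  have hT := D.pos.le
  have h0 : (0:ℝ) ∈ Icc 0 T := ⟨le_rfl, hT⟩
  have hu := h.cont_u
  have hv := h.cont_v
  set g : ℝ → ℝ := fun t ↦ ψ (v t - F (u t)) with hg
  have hgc : Continuous g := by fun_prop
  have hug : ∀ t ∈ Icc 0 T, u t = u 0 + ∫ τ in (0:ℝ)..t, g τ := h.eq_u
  have hi1 : ∀ x y, IntervalIntegrable (fun τ ↦ s + e' τ - a' τ * q (u τ)) volume x y :=
    fun x y ↦ (intervalIntegrable_const.add (D.intervalIntegrable_e x y)).sub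
      ((D.intervalIntegrable_a x y).mul_continuousOn (hq.comp hu).continuousOn)
  have hi2 : ∀ x y, IntervalIntegrable (fun τ ↦ f (u τ) * g τ) volume x y :=
    fun x y ↦ ((hf.comp hu).mul hgc).intervalIntegrable _ _
  refine ⟨g, fun t ↦ s + e' t - a' t * q (u t) - f (u t) * g t,
    ⟨fun t ht ↦ ?_, hgc.continuousOn, h.per_u.symm, ?_⟩, ⟨?_, fun t ht ↦ ?_⟩, ?_⟩
  · have h1 : HasDerivAt (fun t ↦ u 0 + ∫ τ in (0:ℝ)..t, g τ) (g t) t :=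
      (intervalIntegral.integral_hasDerivAt_right (hgc.intervalIntegrable _ _)
        (hgc.stronglyMeasurableAtFilter _ _) hgc.continuousAt).const_add _
    exact h1.hasDerivWithinAt.congr hug (hug t ht)
  · simp only [hg, h.per_u, h.per_v]
  · rw [integrableOn_Icc_iff_integrableOn_Ioc, ← uIoc_of_le hT, ← intervalIntegrable_iff]
    exact (hi1 0 T).sub (hi2 0 T)
  · have h1 := integral_comp_mul_eq hu hgc hf hug ht
    rw [← hF, ← hF] at h1
    have h2 := h.eq_v t ht
    simp only [add_zero] at h2
    rw [intervalIntegral.integral_sub (hi1 _ _) (hi2 _ _), h1]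
    simp only [hg, hφψ]
    linarith
  · filter_upwards [ha, he] with t h1 h2
    rw [h1, h2]
    ring

end

/-- If `q(u) → +∞` as `u → ±∞`, then there is `s₀` such that `(WE_s)` has no `T`-periodic
solution for `s < s₀`, at least one for `s = s₀`, and at least two for `s > s₀`. -/
theorem statement0
    (T : ℝ) (hT : 0 < T)
    (φ f q a e : ℝ → ℝ)
    (hφmono : StrictMono φ) (hφcont : Continuous φ)
    (hφsurj : Function.Surjective φ) (hφ0 : φ 0 = 0)
    (hf : Continuous f) (hq : Continuous q)
    (ha_meas : Measurable a) (ha_bdd : ∃ C : ℝ, ∀ᵐ t ∂(muT T), |a t| ≤ C)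
    (ha_nonneg : ∀ᵐ t ∂(muT T), 0 ≤ a t)
    (ha_mean : (1 / T) * ∫ t in Icc (0:ℝ) T, a t = 1)
    (he_meas : Measurable e) (he_bdd : ∃ C : ℝ, ∀ᵐ t ∂(muT T), |e t| ≤ C)
    (he_mean : (1 / T) * ∫ t in Icc (0:ℝ) T, e t = 0)
    (hq_top : Tendsto q atTop atTop) (hq_bot : Tendsto q atBot atTop) :
    ∃ s₀ : ℝ,
      (∀ s : ℝ, s < s₀ → ¬∃ u : ℝ → ℝ, IsSolWE T φ f q a e s u) ∧
      (∃ u : ℝ → ℝ, IsSolWE T φ f q a e s₀ u) ∧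
      (∀ s : ℝ, s₀ < s → ∃ u₁ u₂ : ℝ → ℝ, IsSolWE T φ f q a e s u₁ ∧
        IsSolWE T φ f q a e s u₂ ∧ ∃ t ∈ Icc (0:ℝ) T, u₁ t ≠ u₂ t) := by
  obtain ⟨Ca, hCa⟩ := ha_bdd
  obtain ⟨Ce, hCe⟩ := he_bdd
  set C : ℝ := max |Ca| |Ce| with hC
  have hC0 : 0 ≤ C := (abs_nonneg _).trans (le_max_left _ _)
  set a' : ℝ → ℝ := fun t ↦ max 0 (min (a t) C) with ha'
  set e' : ℝ → ℝ := fun t ↦ max (-C) (min (e t) C) with he'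
  have haa : ∀ᵐ t ∂muT T, a t = a' t := by
    filter_upwards [hCa, ha_nonneg] with t h1 h2
    have h3 : a t ≤ C :=
      (le_abs_self _).trans (h1.trans ((le_abs_self _).trans (le_max_left _ _)))
    simp only [ha', min_eq_left h3, max_eq_right h2]
  have hee : ∀ᵐ t ∂muT T, e t = e' t := by
    filter_upwards [hCe] with t h1
    have h3 : -C ≤ e t ∧ e t ≤ C := abs_le.1 (h1.trans
      ((le_abs_self _).trans (le_max_right |Ca| |Ce|)))
    simp only [he', min_eq_left h3.2, max_eq_right h3.1]
  have hint : ∀ g g' : ℝ → ℝ, (∀ᵐ t ∂muT T, g t = g' t) →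
      ∫ t in (0:ℝ)..T, g' t = ∫ t in Icc (0:ℝ) T, g t := by
    intro g g' h
    rw [intervalIntegral.integral_of_le hT.le, ← integral_Icc_eq_integral_Ioc]
    exact (integral_congr_ae h).symm
  have D : WEData T a' e' C := by
    refine ⟨hT, measurable_const.max (ha_meas.min measurable_const),
      measurable_const.max (he_meas.min measurable_const), fun t ↦ le_max_left _ _,
      fun t ↦ max_le hC0 (min_le_right _ _),
      fun t ↦ abs_le.2 ⟨le_max_left _ _, max_le (by linarith) (min_le_right _ _)⟩, ?_, ?_⟩
    · rw [hint a a' haa]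
      field_simp at ha_mean
      exact ha_mean
    · rw [hint e e' hee]
      field_simp at he_mean
      simpa using he_mean
  set Φ : ℝ ≃o ℝ := hφmono.orderIsoOfSurjective φ hφsurj with hΦ
  set ψ : ℝ → ℝ := fun x ↦ Φ.symm x with hψdef
  have hψφ : ∀ x, ψ (φ x) = x := Φ.symm_apply_apply
  have hφψ : ∀ x, φ (ψ x) = x := Φ.apply_symm_apply
  have hψ : StrictMono ψ := Φ.symm.strictMono
  have hψc : Continuous ψ := Φ.symm.continuous
  have hψ0 : ψ 0 = 0 := by rw [← hφ0, hψφ, hφ0]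
  set F : ℝ → ℝ := fun x ↦ ∫ τ in (0:ℝ)..x, f τ with hFdef
  have hF : ∀ x, F x = ∫ τ in (0:ℝ)..x, f τ := fun _ ↦ rfl
  have hFc : Continuous F :=
    intervalIntegral.continuous_primitive (fun _ _ ↦ hf.intervalIntegrable _ _) 0
  set A : Set ℝ := {s | ∃ u v : ℝ → ℝ,
    IsSys T ψ (fun _ x ↦ F x) (fun _ x ↦ q x) (fun _ _ ↦ 0) a' e' s u v} with hA
  have hA_ne : A.Nonempty := by
    obtain ⟨u, v, -, -, h, -⟩ := (isStrictUpper_zero (q := q) D hψ0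
      (show F 0 = 0 by simp [hF])).exists_two D hψc hψ hψ0 hf hF hq hq_top hq_bot
    exact ⟨_, u, v, h⟩
  obtain ⟨⟨Q₀, -, hQ₀⟩, -⟩ := exists_bounds_of_tendsto hq hq_top hq_bot
  have hA_bdd : BddBelow A := ⟨-Q₀, fun s ⟨u, v, h⟩ ↦
    D.exists_le_of_isSys hq h fun t _ ↦ hQ₀ (u t)⟩
  refine ⟨sInf A, fun s hs ↦ ?_, ?_, fun s hs ↦ ?_⟩
  · rintro ⟨u, hu⟩
    exact not_lt.2 (csInf_le hA_bdd (hu.exists_isSys D haa hee hφcont hψφ hf hF hFc)) hs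
  · obtain ⟨s, -, hs, hsA⟩ := exists_seq_tendsto_sInf hA_ne hA_bdd
    obtain ⟨u, v, h⟩ := exists_isSys_of_tendsto D hψc hψ hψ0 hFc hq hq_top hq_bot hs hsA
    exact ⟨u, h.isSolWE D haa hee hψc hφψ hf hq hF hFc⟩
  · obtain ⟨s₁, ⟨u, v, h⟩, hlt⟩ := exists_lt_of_csInf_lt hA_ne hs
    obtain ⟨u₁, v₁, u₂, v₂, h₁, h₂, hne⟩ :=
      (h.isStrictUpper D hq hlt).exists_two D hψc hψ hψ0 hf hF hq hq_top hq_bot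
    exact ⟨u₁, u₂, h₁.isSolWE D haa hee hψc hφψ hf hq hF hFc,
      h₂.isSolWE D haa hee hψc hφψ hf hq hF hFc, hne⟩
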